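/- arXiv:2504.10436 — 10 statements merged into one kernel-verified Lean document; each statement's English description precedes it below -/
import Mathlib

section
/- Let a, b, c, m, p be positive natural numbers, let K : Fin m → Matrix (Fin b) (Fin a) ℂ be any family of matrices, and let F : Fin p → Matrix (Fin c) (Fin b) ℂ satisfy the completeness relation ∑ q, (F q)ᴴ * F q = (1 : Matrix (Fin b) (Fin b) ℂ). Then Submodule.span ℂ { (K i)ᴴ * K j : i j : Fin m } ≤ Submodule.span ℂ { (F q * K i)ᴴ * (F r * K j) : i j : Fin m, q r : Fin p }, as submodules of Matrix (Fin a) (Fin a) ℂ. (This is the inclusion S_Φ ⊆ S_{Ψ∘Φ} of the paper's Lemma on operator-system homomorphisms, where K and F are Kraus families of quantum channels Φ and Ψ.) -/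
open Matrix
/-- The inclusion `S_Φ ⊆ S_{Ψ∘Φ}` of operator systems, where `K` is a Kraus family of a
channel `Φ` and `F` is a Kraus family of a (trace-preserving) channel `Ψ`. -/
theorem operatorSystem_le_of_comp
    (a b c m p : ℕ) (ha : 0 < a) (hb : 0 < b) (hc : 0 < c) (hm : 0 < m) (hp : 0 < p)
    (K : Fin m → Matrix (Fin b) (Fin a) ℂ)
    (F : Fin p → Matrix (Fin c) (Fin b) ℂ)
    (hF : ∑ q, (F q)ᴴ * F q = (1 : Matrix (Fin b) (Fin b) ℂ)) :
    Submodule.span ℂ {X : Matrix (Fin a) (Fin a) ℂ | ∃ i j : Fin m, X = (K i)ᴴ * K j} ≤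
      Submodule.span ℂ {X : Matrix (Fin a) (Fin a) ℂ |
        ∃ (i j : Fin m) (q r : Fin p), X = (F q * K i)ᴴ * (F r * K j)} := by
  rw [Submodule.span_le]
  rintro X ⟨i, j, rfl⟩
  have h : (K i)ᴴ * K j = ∑ q, (F q * K i)ᴴ * (F q * K j) := by
    calc (K i)ᴴ * K j = (K i)ᴴ * (∑ q, (F q)ᴴ * F q) * K j := by rw [hF, Matrix.mul_one]
      _ = _ := by
        rw [Matrix.mul_sum, Matrix.sum_mul]
        refine Finset.sum_congr rfl fun q _ => ?_
        rw [Matrix.conjTranspose_mul]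
        simp only [Matrix.mul_assoc]
  rw [SetLike.mem_coe, h]
  exact Submodule.sum_mem _ fun q _ => Submodule.subset_span ⟨i, j, q, q, rfl⟩
end

section
/- Let a, b, c, e, p be positive natural numbers, let V : Matrix (Fin b × Fin e) (Fin a) ℂ be an isometry (Vᴴ * V = 1), and define K : Fin e → Matrix (Fin b) (Fin a) ℂ by (K x) i j := V (i, x) j. Let F : Fin p → Matrix (Fin c) (Fin b) ℂ be any family. Then Submodule.span ℂ { (F q * K x)ᴴ * (F r * K y) : q r : Fin p, x y : Fin e } equals the image, under the linear map M ↦ Vᴴ * M * V, of the submodule Submodule.span ℂ { Y ⊗ₖ W : Y ∈ Submodule.span ℂ {(F q)ᴴ * F r : q, r}, W : Matrix (Fin e) (Fin e) ℂ } of Matrix ((Fin b × Fin e)) ((Fin b × Fin e)) ℂ. (This is the identity S_{Ψ∘Φ} = Vᴴ (S_Ψ ⊗ B(H_E)) V of the paper's Lemma on operator-system homomorphisms, where V is a Stinespring isometry of Φ with Kraus family K and F is a Kraus family of Ψ.) -/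
open Matrix Kronecker

/-- Conjugation `M ↦ Vᴴ * M * V` as a ℂ-linear map on matrices. -/
noncomputable def conjByIsometry {n m : Type*} [Fintype n] [Fintype m]
    (V : Matrix n m ℂ) : Matrix n n ℂ →ₗ[ℂ] Matrix m m ℂ where
  toFun M := Vᴴ * M * V
  map_add' M N := by simp [Matrix.mul_add, Matrix.add_mul]
  map_smul' c M := by simp [Matrix.mul_smul, Matrix.smul_mul]

theorem conj_kron_aux {b e a : ℕ} (V : Matrix (Fin b × Fin e) (Fin a) ℂ)
    (K : Fin e → Matrix (Fin b) (Fin a) ℂ)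
    (hK : ∀ (x : Fin e) (i : Fin b) (j : Fin a), K x i j = V (i, x) j)
    (Y : Matrix (Fin b) (Fin b) ℂ) (W : Matrix (Fin e) (Fin e) ℂ) :
    conjByIsometry V (Y ⊗ₖ W) = ∑ x, ∑ y, W x y • ((K x)ᴴ * Y * K y) := by
  ext i j
  change (Vᴴ * (Y ⊗ₖ W) * V) i j = _
  simp only [Matrix.sum_apply, Matrix.smul_apply, Matrix.mul_apply, Matrix.conjTranspose_apply,
    Matrix.kroneckerMap_apply, hK, smul_eq_mul, Fintype.sum_prod_type, Finset.sum_mul,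
    Finset.mul_sum]
  -- left order: k' y k x; right order: x y k' k
  rw [Finset.sum_comm]
  conv_rhs => rw [Finset.sum_comm]
  refine Finset.sum_congr rfl fun y _ => ?_
  conv_rhs => rw [Finset.sum_comm]
  refine Finset.sum_congr rfl fun k' _ => ?_
  conv_rhs => rw [Finset.sum_comm]
  refine Finset.sum_congr rfl fun k _ => Finset.sum_congr rfl fun x _ => ?_
  ring

/-- The identity `S_{Ψ∘Φ} = Vᴴ (S_Ψ ⊗ B(H_E)) V`, where `V` is a Stinespring isometry of the
channel `Φ` with associated Kraus family `K`, and `F` is a Kraus family of `Ψ`. -/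
theorem operatorSystem_comp_eq_conj_tensor
    (a b c e p : ℕ) (ha : 0 < a) (hb : 0 < b) (hc : 0 < c) (he : 0 < e) (hp : 0 < p)
    (V : Matrix (Fin b × Fin e) (Fin a) ℂ)
    (hV : Vᴴ * V = (1 : Matrix (Fin a) (Fin a) ℂ))
    (K : Fin e → Matrix (Fin b) (Fin a) ℂ)
    (hK : ∀ (x : Fin e) (i : Fin b) (j : Fin a), K x i j = V (i, x) j)
    (F : Fin p → Matrix (Fin c) (Fin b) ℂ) :
    Submodule.span ℂ {X : Matrix (Fin a) (Fin a) ℂ |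
        ∃ (q r : Fin p) (x y : Fin e), X = (F q * K x)ᴴ * (F r * K y)} =
      Submodule.map (conjByIsometry V)
        (Submodule.span ℂ {Z : Matrix (Fin b × Fin e) (Fin b × Fin e) ℂ |
          ∃ Y ∈ Submodule.span ℂ
              {X : Matrix (Fin b) (Fin b) ℂ | ∃ q r : Fin p, X = (F q)ᴴ * F r},
            ∃ W : Matrix (Fin e) (Fin e) ℂ, Z = Y ⊗ₖ W}) := by
  apply le_antisymm
  · rw [Submodule.span_le]
    rintro _ ⟨q, r, x, y, rfl⟩
    refine ⟨((F q)ᴴ * F r) ⊗ₖ Matrix.single x y (1 : ℂ),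
      Submodule.subset_span ⟨_, Submodule.subset_span ⟨q, r, rfl⟩, _, rfl⟩, ?_⟩
    rw [conj_kron_aux V K hK, Finset.sum_eq_single x, Finset.sum_eq_single y]
    · simp [Matrix.mul_assoc]
    · intro y' _ h
      simp [Matrix.single_apply, h.symm]
    · simp
    · intro x' _ h
      simp [Matrix.single_apply, h.symm]
    · simp
  · rw [Submodule.map_span_le]
    rintro _ ⟨Y, hY, W, rfl⟩
    rw [conj_kron_aux V K hK]
    refine Submodule.sum_mem _ fun x _ => Submodule.sum_mem _ fun y _ =>
      Submodule.smul_mem _ _ ?_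
    induction hY using Submodule.span_induction with
    | mem Z hZ =>
      obtain ⟨q, r, rfl⟩ := hZ
      exact Submodule.subset_span ⟨q, r, x, y, by simp [Matrix.mul_assoc]⟩
    | zero => simp
    | add A B _ _ hA hB =>
      rw [Matrix.mul_add, Matrix.add_mul]
      exact Submodule.add_mem _ hA hB
    | smul t A _ hA =>
      rw [Matrix.mul_smul, Matrix.smul_mul]
      exact Submodule.smul_mem _ _ hA
end

section
/- Let d, m be positive natural numbers and K : Fin m → Matrix (Fin d) (Fin d) ℂ satisfy ∑ i, (K i)ᴴ * K i = 1. For l ≥ 1 and a word w : Fin l → Fin m let K_w := K (w 0) * K (w 1) * ⋯ * K (w (l−1)) (ordered matrix product), and define S l := Submodule.span ℂ { (K_w)ᴴ * K_{w'} : w, w' : Fin l → Fin m } ⊆ Matrix (Fin d) (Fin d) ℂ. Then: (a) S l ≤ S (l+1) for every l ≥ 1; (b) if S l = S (l+1) for some l ≥ 1, then S (l+j) = S l for every j : ℕ; (c) S l = S (d²) for every l ≥ d². (This is the paper's stabilization lemma for the operator systems S_{Ψ^l} of the discrete quantum Markov semigroup generated by a channel Ψ with Kraus family K.) -/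
open Matrix

/-- Stabilization of the operator systems `S_{Ψ^l}` of the discrete quantum Markov semigroup
generated by a channel `Ψ` with Kraus family `K` on a `d`-dimensional system:
(a) the chain is increasing, (b) once it is stationary at one step it is stationary forever,
and (c) it stabilizes by time `d²`. -/
theorem operatorSystem_chain_stabilizes
    (d m : ℕ) (hd : 0 < d) (hm : 0 < m)
    (K : Fin m → Matrix (Fin d) (Fin d) ℂ)
    (hK : ∑ i, (K i)ᴴ * K i = (1 : Matrix (Fin d) (Fin d) ℂ))
    (S : ℕ → Submodule ℂ (Matrix (Fin d) (Fin d) ℂ))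
    (hS : ∀ l : ℕ, S l = Submodule.span ℂ
      {X : Matrix (Fin d) (Fin d) ℂ | ∃ w w' : Fin l → Fin m,
        X = ((List.ofFn fun i => K (w i)).prod)ᴴ * (List.ofFn fun i => K (w' i)).prod}) :
    (∀ l : ℕ, 1 ≤ l → S l ≤ S (l + 1)) ∧
    (∀ l : ℕ, 1 ≤ l → S l = S (l + 1) → ∀ j : ℕ, S (l + j) = S l) ∧
    (∀ l : ℕ, d ^ 2 ≤ l → S l = S (d ^ 2)) := by
  classical
  let Φ : Submodule ℂ (Matrix (Fin d) (Fin d) ℂ) → Submodule ℂ (Matrix (Fin d) (Fin d) ℂ) :=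
    fun T => ⨆ (i : Fin m) (j : Fin m), T.map
      ((LinearMap.mulLeft ℂ ((K i)ᴴ)).comp (LinearMap.mulRight ℂ (K j)))
  have hΦ : ∀ l, S (l + 1) = Φ (S l) := by
    intro l
    apply le_antisymm
    · rw [hS (l + 1), Submodule.span_le]
      rintro X ⟨w, w', rfl⟩
      have h1 : ∀ v : Fin (l + 1) → Fin m, (List.ofFn fun i => K (v i)).prod
          = (List.ofFn fun i : Fin l => K (v i.castSucc)).prod * K (v (Fin.last l)) := by
        intro v
        rw [List.ofFn_succ_last]
        simp
      refine Submodule.mem_iSup_of_mem (w (Fin.last l)) (Submodule.mem_iSup_of_mem (w' (Fin.last l)) ?_)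
      refine ⟨((List.ofFn fun i : Fin l => K (w i.castSucc)).prod)ᴴ *
        (List.ofFn fun i : Fin l => K (w' i.castSucc)).prod, ?_, ?_⟩
      · rw [hS l]
        exact Submodule.subset_span ⟨_, _, rfl⟩
      · rw [h1 w, h1 w']
        simp [Matrix.conjTranspose_mul, Matrix.mul_assoc]
    · refine iSup_le fun i => iSup_le fun j => ?_
      rw [hS l, Submodule.map_span_le]
      rintro X ⟨w, w', rfl⟩
      rw [hS (l + 1)]
      refine Submodule.subset_span ⟨Fin.snoc w i, Fin.snoc w' j, ?_⟩
      have h1 : ∀ (v : Fin l → Fin m) (a : Fin m),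
          (List.ofFn fun i => K ((Fin.snoc v a : Fin (l + 1) → Fin m) i)).prod
          = (List.ofFn fun i : Fin l => K (v i)).prod * K a := by
        intro v a
        rw [List.ofFn_succ_last]
        simp
      rw [h1, h1]
      simp [Matrix.conjTranspose_mul, Matrix.mul_assoc]
  have ha : ∀ l, S l ≤ S (l + 1) := by
    intro l
    rw [hS l, Submodule.span_le]
    rintro X ⟨w, w', rfl⟩
    have h1 : ((List.ofFn fun i => K (w i)).prod)ᴴ * (List.ofFn fun i => K (w' i)).prod
        = ∑ a, (K a * (List.ofFn fun i => K (w i)).prod)ᴴ *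
          (K a * (List.ofFn fun i => K (w' i)).prod) := by
      calc _ = ((List.ofFn fun i => K (w i)).prod)ᴴ * (∑ i, (K i)ᴴ * K i) *
            (List.ofFn fun i => K (w' i)).prod := by rw [hK, Matrix.mul_one]
        _ = _ := by
          simp only [Matrix.mul_sum, Matrix.sum_mul, Matrix.conjTranspose_mul, Matrix.mul_assoc]
    rw [h1, SetLike.mem_coe]
    refine Submodule.sum_mem _ fun a _ => ?_
    rw [hS (l + 1)]
    refine Submodule.subset_span ⟨Fin.cons a w, Fin.cons a w', ?_⟩
    simp [List.ofFn_succ]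
  have hb : ∀ l, S l = S (l + 1) → ∀ j : ℕ, S (l + j) = S l := by
    intro l h j
    induction j with
    | zero => rfl
    | succ j ih => rw [← add_assoc, hΦ, ih, ← hΦ, ← h]
  refine ⟨fun l _ => ha l, fun l _ => hb l, ?_⟩
  have hc : ∀ n : ℕ, (∃ k < n, S k = S (k + 1)) ∨ n ≤ Module.finrank ℂ (S n) := by
    intro n
    induction n with
    | zero => right; exact Nat.zero_le _
    | succ n ih =>
      rcases ih with ⟨k, hk, h⟩ | ih
      · exact Or.inl ⟨k, by omega, h⟩
      · by_cases h : S n = S (n + 1)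
        · exact Or.inl ⟨n, by omega, h⟩
        · right
          have := Submodule.finrank_lt_finrank_of_lt (lt_of_le_of_ne (ha n) h)
          omega
  intro l hl
  rcases hc (d ^ 2 + 1) with ⟨k, hk, h⟩ | h
  · have e1 := hb k h (l - k)
    have e2 := hb k h (d ^ 2 - k)
    rw [show k + (l - k) = l by omega] at e1
    rw [show k + (d ^ 2 - k) = d ^ 2 by omega] at e2
    rw [e1, e2]
  · have h2 := Submodule.finrank_le (S (d ^ 2 + 1))
    have h3 : Module.finrank ℂ (Matrix (Fin d) (Fin d) ℂ) = d ^ 2 := by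
      simp [Module.finrank_matrix, sq]
    omega
end

section
/- Let V and W be finite-dimensional complex vector spaces and let f : V →ₗ[ℂ] V and g : W →ₗ[ℂ] W be linear endomorphisms such that: (i) every eigenvalue λ of f (respectively of g) satisfies ‖λ‖ ≤ 1, and (ii) for every λ : ℂ with ‖λ‖ = 1, the generalized eigenspace of f (respectively of g) at λ equals its eigenspace at λ. Define the peripheral space 𝒳(f) := ⨆ (λ : ℂ) (_ : ‖λ‖ = 1), eigenspace f λ, and similarly 𝒳(g) and 𝒳(f ⊗ g) for the tensor-product endomorphism TensorProduct.map f g of V ⊗[ℂ] W. Then 𝒳(f ⊗ g) equals the submodule of V ⊗ W spanned by the pure tensors x ⊗ y with x ∈ 𝒳(f) and y ∈ 𝒳(g); that is, the peripheral space is multiplicative: 𝒳(f ⊗ g) = 𝒳(f) ⊗ 𝒳(g). -/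
open Module

open scoped TensorProduct in
theorem tmul_mem_maxGen_aux
    {V W : Type*} [AddCommGroup V] [Module ℂ V] [AddCommGroup W] [Module ℂ W]
    (f : V →ₗ[ℂ] V) (g : W →ₗ[ℂ] W) {a b : ℂ} {x : V} {y : W}
    (hx : x ∈ Module.End.maxGenEigenspace f a) (hy : y ∈ Module.End.maxGenEigenspace g b) :
    x ⊗ₜ[ℂ] y ∈ Module.End.maxGenEigenspace (TensorProduct.map f g) (a * b) := by
  rw [Module.End.mem_maxGenEigenspace] at hx hy
  obtain ⟨m, hm⟩ := hx
  obtain ⟨n, hn⟩ := hy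
  let S : Module.End ℂ (V ⊗[ℂ] W) := TensorProduct.map (f - a • (1 : Module.End ℂ V)) g
  let R : Module.End ℂ (V ⊗[ℂ] W) :=
    TensorProduct.map (a • (1 : Module.End ℂ V)) (g - b • (1 : Module.End ℂ W))
  have hc : Commute S R := by
    apply TensorProduct.ext'
    intro v w
    simp [S, R]
  have hSR : TensorProduct.map f g - (a * b) • (1 : Module.End ℂ (V ⊗[ℂ] W)) = S + R := by
    apply TensorProduct.ext'
    intro v w
    simp [S, R, TensorProduct.sub_tmul, TensorProduct.tmul_sub, TensorProduct.smul_tmul',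
      smul_smul, mul_comm]
  have h1 : x ⊗ₜ[ℂ] y ∈ S.genEigenspace 0 ⊤ := by
    refine (Module.End.mem_maxGenEigenspace S 0 _).2 ⟨m, ?_⟩
    rw [zero_smul, sub_zero, TensorProduct.map_pow, TensorProduct.map_tmul, hm,
      TensorProduct.zero_tmul]
  have h2 : x ⊗ₜ[ℂ] y ∈ R.genEigenspace 0 ⊤ := by
    refine (Module.End.mem_maxGenEigenspace R 0 _).2 ⟨n, ?_⟩
    rw [zero_smul, sub_zero, TensorProduct.map_pow, TensorProduct.map_tmul, hn,
      TensorProduct.tmul_zero]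
  have h3 := Module.End.genEigenspace_inf_le_add S R 0 0 ⊤ ⊤ hc ⟨h1, h2⟩
  rw [Module.End.maxGenEigenspace_eq_maxGenEigenspace_zero, hSR]
  simpa using h3

theorem eigenvalue_aux {V : Type*} [AddCommGroup V] [Module ℂ V]
    {f : V →ₗ[ℂ] V} {a : ℂ} {x : V} (hx : x ∈ Module.End.maxGenEigenspace f a) (h0 : x ≠ 0) :
    Module.End.HasEigenvalue f a := by
  have : Module.End.HasUnifEigenvalue f a ⊤ := by
    intro h
    exact h0 (by simpa [Module.End.maxGenEigenspace, h] using hx)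
  exact this.lt zero_lt_one

/-- Multiplicativity of the peripheral space: for endomorphisms `f`, `g` of finite-dimensional
complex vector spaces whose eigenvalues lie in the closed unit disk and whose peripheral
eigenvalues are semisimple (generalized eigenspace = eigenspace), the peripheral space of
`f ⊗ g` is spanned by the pure tensors of peripheral vectors: `𝒳(f ⊗ g) = 𝒳(f) ⊗ 𝒳(g)`. -/
theorem peripheralSpace_tensor
    (V W : Type*) [AddCommGroup V] [Module ℂ V] [AddCommGroup W] [Module ℂ W]
    [FiniteDimensional ℂ V] [FiniteDimensional ℂ W]
    (f : V →ₗ[ℂ] V) (g : W →ₗ[ℂ] W)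
    (hf1 : ∀ μ : ℂ, Module.End.HasEigenvalue f μ → ‖μ‖ ≤ 1)
    (hg1 : ∀ μ : ℂ, Module.End.HasEigenvalue g μ → ‖μ‖ ≤ 1)
    (hf2 : ∀ μ : ℂ, ‖μ‖ = 1 →
      Module.End.maxGenEigenspace f μ = Module.End.eigenspace f μ)
    (hg2 : ∀ μ : ℂ, ‖μ‖ = 1 →
      Module.End.maxGenEigenspace g μ = Module.End.eigenspace g μ) :
    (⨆ (μ : ℂ) (_ : ‖μ‖ = 1), Module.End.eigenspace (TensorProduct.map f g) μ) =
      Submodule.span ℂ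
        {z : TensorProduct ℂ V W |
          ∃ x ∈ (⨆ (μ : ℂ) (_ : ‖μ‖ = 1), Module.End.eigenspace f μ),
          ∃ y ∈ (⨆ (μ : ℂ) (_ : ‖μ‖ = 1), Module.End.eigenspace g μ),
            z = x ⊗ₜ[ℂ] y} := by
  set T := TensorProduct.map f g with hT
  set Xf := ⨆ (μ : ℂ) (_ : ‖μ‖ = 1), Module.End.eigenspace f μ with hXf
  set Xg := ⨆ (μ : ℂ) (_ : ‖μ‖ = 1), Module.End.eigenspace g μ with hXg
  set A := ⨆ (μ : ℂ) (_ : ‖μ‖ = 1), Module.End.eigenspace T μ with hA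
  set P := Submodule.span ℂ {z : TensorProduct ℂ V W | ∃ x ∈ Xf, ∃ y ∈ Xg, z = x ⊗ₜ[ℂ] y} with hP
  let B := ⨆ μ ∈ {μ : ℂ | ‖μ‖ ≠ 1}, Module.End.maxGenEigenspace T μ
  have hAB : Disjoint A B := by
    have h := (Module.End.independent_maxGenEigenspace T).disjoint_biSup_biSup
      (s := {μ : ℂ | ‖μ‖ = 1}) (t := {μ : ℂ | ‖μ‖ ≠ 1})
      (Set.disjoint_left.2 fun _ h1 h2 => h2 h1)
    refine h.mono_left ?_
    exact iSup₂_mono fun μ _ => Module.End.eigenspace_le_maxGenEigenspace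
  have hPA : P ≤ A := by
    rw [hP, Submodule.span_le]
    rintro _ ⟨x, hx, y, hy, rfl⟩
    have key : Xf ≤ A.comap ((TensorProduct.mk ℂ V W).flip y) := by
      refine iSup₂_le fun a ha x hx => ?_
      have : Xg ≤ A.comap (TensorProduct.mk ℂ V W x) := by
        refine iSup₂_le fun b hb y hy => ?_
        refine Submodule.mem_iSup_of_mem (a * b) (Submodule.mem_iSup_of_mem (by simp [ha, hb]) ?_)
        rw [Module.End.mem_eigenspace_iff] at hx hy ⊢
        simp [hT, hx, hy, TensorProduct.smul_tmul', TensorProduct.tmul_smul, smul_smul, mul_comm]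
      exact this hy
    exact key hx
  have hpiece : ∀ a b : ℂ, ∀ x ∈ Module.End.maxGenEigenspace f a,
      ∀ y ∈ Module.End.maxGenEigenspace g b, x ⊗ₜ[ℂ] y ∈ P ⊔ B := by
    intro a b x hx y hy
    by_cases hab : ‖a * b‖ = 1
    · apply Submodule.mem_sup_left
      by_cases hx0 : x = 0
      · simp [hx0]
      by_cases hy0 : y = 0
      · simp [hy0]
      have ha := hf1 a (eigenvalue_aux hx hx0)
      have hb := hg1 b (eigenvalue_aux hy hy0)
      rw [norm_mul] at hab
      have ha1 : ‖a‖ = 1 := by nlinarith [norm_nonneg a, norm_nonneg b]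
      have hb1 : ‖b‖ = 1 := by nlinarith [norm_nonneg a, norm_nonneg b]
      rw [hf2 a ha1] at hx
      rw [hg2 b hb1] at hy
      exact Submodule.subset_span ⟨x, Submodule.mem_iSup_of_mem a (Submodule.mem_iSup_of_mem ha1 hx),
        y, Submodule.mem_iSup_of_mem b (Submodule.mem_iSup_of_mem hb1 hy), rfl⟩
    · apply Submodule.mem_sup_right
      exact Submodule.mem_iSup_of_mem (a * b)
        (Submodule.mem_iSup_of_mem hab (tmul_mem_maxGen_aux f g hx hy))
  have htop : P ⊔ B = ⊤ := by
    rw [eq_top_iff, ← TensorProduct.span_tmul_eq_top, Submodule.span_le]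
    rintro _ ⟨x, y, rfl⟩
    have key : (⊤ : Submodule ℂ V) ≤ (P ⊔ B).comap ((TensorProduct.mk ℂ V W).flip y) := by
      rw [← Module.End.iSup_maxGenEigenspace_eq_top f]
      refine iSup_le fun a x hx => ?_
      have : (⊤ : Submodule ℂ W) ≤ (P ⊔ B).comap (TensorProduct.mk ℂ V W x) := by
        rw [← Module.End.iSup_maxGenEigenspace_eq_top g]
        exact iSup_le fun b y hy => hpiece a b x hx y hy
      exact this (Submodule.mem_top (x := y))
    exact key (Submodule.mem_top (x := x))
  refine le_antisymm ?_ hPA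
  have : A = P ⊔ B ⊓ A := by rw [← sup_inf_assoc_of_le B hPA, htop, top_inf_eq]
  rw [this, inf_comm, hAB.eq_bot, sup_bot_eq]
end

section
/- Let S ⊆ Matrix ι ι ℂ be the block *-algebra ⊕_k (1_{d k} ⊗ M_{m k}(ℂ)) of the context. Then the independence number of S equals ∑_k d k; that is: (i) there exists an independent family for S of size ∑ k, d k, and (ii) every independent family for S has size at most ∑ k, d k. (Part of the paper's Lemma computing the independence numbers of *-algebras: α(S) = ∑_k d_k.) -/
open Matrix Kronecker ComplexOrder

noncomputable section

/-- The index type of the block decomposition `⊕ₖ (Fin (d k) × Fin (m k))`. -/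
abbrev BlockIdx {K : ℕ} (d m : Fin K → ℕ) : Type :=
  (k : Fin K) × (Fin (d k) × Fin (m k))

/-- The matrix supported on the diagonal block `k`, where it equals `1_{d k} ⊗ B`. -/
def blockMatrix {K : ℕ} (d m : Fin K → ℕ) (k : Fin K)
    (B : Matrix (Fin (m k)) (Fin (m k)) ℂ) :
    Matrix (BlockIdx d m) (BlockIdx d m) ℂ := fun p q =>
  if hp : p.1 = k then
    if hq : q.1 = k then
      if Fin.cast (congrArg d hp) p.2.1 = Fin.cast (congrArg d hq) q.2.1 then
        B (Fin.cast (congrArg m hp) p.2.2) (Fin.cast (congrArg m hq) q.2.2)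
      else 0
    else 0
  else 0

/-- The block *-algebra `⊕ₖ (1_{d k} ⊗ M_{m k}(ℂ))`, as the span of the single-block
matrices `blockMatrix d m k B`. -/
def blockAlgebra {K : ℕ} (d m : Fin K → ℕ) :
    Submodule ℂ (Matrix (BlockIdx d m) (BlockIdx d m) ℂ) :=
  Submodule.span ℂ
    {A | ∃ (k : Fin K) (B : Matrix (Fin (m k)) (Fin (m k)) ℂ), A = blockMatrix d m k B}

/-- A state: a positive semidefinite matrix of trace one. -/
def IsState {ι : Type*} [Fintype ι] (ρ : Matrix ι ι ℂ) : Prop :=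
  ρ.PosSemidef ∧ ρ.trace = 1

/-- An independent family of states for a subspace `S` of matrices: the `|v⟩⟨w|` built from
vectors in the ranges of two distinct members are Hilbert–Schmidt orthogonal to `S`. -/
def IsIndepFamily {ι : Type*} [Fintype ι] (S : Submodule ℂ (Matrix ι ι ℂ))
    {M : ℕ} (ρ : Fin M → Matrix ι ι ℂ) : Prop :=
  (∀ i, IsState (ρ i)) ∧
  ∀ i j : Fin M, i ≠ j →
    ∀ v ∈ Set.range (ρ i).mulVec, ∀ w ∈ Set.range (ρ j).mulVec,
      ∀ Y ∈ S, Matrix.trace (Yᴴ * Matrix.vecMulVec v (star w)) = 0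

/-- A private independent family: an independent family whose state differences are also
orthogonal to `S`. -/
def IsPrivateIndepFamily {ι : Type*} [Fintype ι] (S : Submodule ℂ (Matrix ι ι ℂ))
    {M : ℕ} (ρ : Fin M → Matrix ι ι ℂ) : Prop :=
  IsIndepFamily S ρ ∧
  ∀ i j : Fin M, i ≠ j → ∀ Y ∈ S, Matrix.trace (Yᴴ * (ρ i - ρ j)) = 0

/-- A Knill–Laflamme projection for `S`: an orthogonal projection `P` with `P S P ⊆ ℂ P`. -/
def IsKLProjection {ι : Type*} [Fintype ι] (S : Submodule ℂ (Matrix ι ι ℂ))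
    (P : Matrix ι ι ℂ) : Prop :=
  Pᴴ = P ∧ P * P = P ∧ ∀ Y ∈ S, ∃ c : ℂ, P * Y * P = c • P

/-- An entanglement-assisted independent family of size `M` for `S`. -/
def IsEAIndepFamily {ι : Type*} [Fintype ι] [DecidableEq ι]
    (S : Submodule ℂ (Matrix ι ι ℂ)) (M : ℕ) : Prop :=
  ∃ (n r : ℕ), 1 ≤ n ∧ 1 ≤ r ∧
    ∃ ρ : Matrix (Fin n) (Fin n) ℂ, IsState ρ ∧
      ∃ V : Fin M → Matrix (ι × Fin r) (Fin n) ℂ,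
        (∀ i, (V i)ᴴ * V i = 1) ∧
        ∀ i i' : Fin M, i ≠ i' → ∀ Y ∈ S, ∀ W : Matrix (Fin r) (Fin r) ℂ,
          Matrix.trace ((Y ⊗ₖ W)ᴴ * (V i * ρ * (V i')ᴴ)) = 0

end

theorem aux_trace {ι : Type*} [Fintype ι] (Y : Matrix ι ι ℂ) (v w : ι → ℂ) :
    Matrix.trace (Yᴴ * Matrix.vecMulVec v (star w))
      = ∑ p, ∑ q, star (Y q p) * (v q * star (w p)) := by
  simp [Matrix.trace, Matrix.mul_apply, Matrix.vecMulVec_apply]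

theorem blockMatrix_same {K : ℕ} (d m : Fin K → ℕ) (k : Fin K)
    (B : Matrix (Fin (m k)) (Fin (m k)) ℂ) (x y : Fin (d k)) (a b : Fin (m k)) :
    blockMatrix d m k B ⟨k, x, a⟩ ⟨k, y, b⟩ = if x = y then B a b else 0 := by
  simp [blockMatrix]

theorem blockMatrix_ne_left {K : ℕ} (d m : Fin K → ℕ) (k : Fin K)
    (B : Matrix (Fin (m k)) (Fin (m k)) ℂ) (p q : BlockIdx d m) (h : p.1 ≠ k) :
    blockMatrix d m k B p q = 0 := by
  simp [blockMatrix, h]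

theorem blockMatrix_ne_right {K : ℕ} (d m : Fin K → ℕ) (k : Fin K)
    (B : Matrix (Fin (m k)) (Fin (m k)) ℂ) (p q : BlockIdx d m) (h : q.1 ≠ k) :
    blockMatrix d m k B p q = 0 := by
  simp [blockMatrix, h]

theorem block_trace {K : ℕ} (d m : Fin K → ℕ) (k : Fin K)
    (B : Matrix (Fin (m k)) (Fin (m k)) ℂ) (v w : BlockIdx d m → ℂ) :
    Matrix.trace ((blockMatrix d m k B)ᴴ * Matrix.vecMulVec v (star w))
      = ∑ x, ∑ b, ∑ a, star (B a b) * (v ⟨k, x, a⟩ * star (w ⟨k, x, b⟩)) := by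
  rw [aux_trace, Fintype.sum_sigma, Finset.sum_eq_single k]
  · rw [Fintype.sum_prod_type]
    refine Finset.sum_congr rfl fun x _ => Finset.sum_congr rfl fun b _ => ?_
    rw [Fintype.sum_sigma, Finset.sum_eq_single k]
    · rw [Fintype.sum_prod_type, Finset.sum_eq_single x]
      · simp [blockMatrix_same]
      · intro y _ hy
        simp [blockMatrix_same, hy]
      · simp
    · intro k' _ hk
      refine Finset.sum_eq_zero fun q _ => ?_
      rw [blockMatrix_ne_left _ _ _ _ _ _ hk]; simp
    · simp
  · intro k' _ hk
    refine Finset.sum_eq_zero fun p _ => Finset.sum_eq_zero fun q _ => ?_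
    rw [blockMatrix_ne_right _ _ _ _ _ _ hk]; simp
  · simp

theorem indep_exists {K : ℕ} (d m : Fin K → ℕ) (hm : ∀ k, 1 ≤ m k) :
    ∃ ρ : Fin (∑ k, d k) → Matrix (BlockIdx d m) (BlockIdx d m) ℂ,
      IsIndepFamily (blockAlgebra d m) ρ := by
  classical
  let e : Fin (∑ k, d k) ≃ (Σ k, Fin (d k)) := finSigmaFinEquiv.symm
  let P : Fin (∑ k, d k) → BlockIdx d m := fun i => ⟨(e i).1, (e i).2, ⟨0, hm _⟩⟩
  refine ⟨fun i => Matrix.diagonal (Pi.single (P i) 1), fun i => ⟨?_, ?_⟩, ?_⟩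
  · apply Matrix.PosSemidef.diagonal
    intro p
    by_cases h : p = P i
    · subst h; simp
    · simp [h]
  · simp [Matrix.trace_diagonal]
  · rintro i j hij _ ⟨v, rfl⟩ _ ⟨w, rfl⟩ Y hY
    have key : ∀ (i) (v : BlockIdx d m → ℂ) (k) (x : Fin (d k)) (a : Fin (m k)),
        (⟨k, x⟩ : Σ k, Fin (d k)) ≠ e i →
        ((Matrix.diagonal (Pi.single (P i) 1)).mulVec v) ⟨k, x, a⟩ = 0 := by
      intro i v k x a h
      rw [Matrix.mulVec_diagonal, Pi.single_eq_of_ne, zero_mul]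
      intro h'
      apply h
      exact congrArg (fun p : BlockIdx d m => (⟨p.1, p.2.1⟩ : Σ k, Fin (d k))) h'
    unfold blockAlgebra at hY
    induction hY using Submodule.span_induction with
    | mem Y hY =>
      obtain ⟨k, B, rfl⟩ := hY
      rw [block_trace]
      refine Finset.sum_eq_zero fun x _ => Finset.sum_eq_zero fun b _ =>
        Finset.sum_eq_zero fun a _ => ?_
      by_cases h : (⟨k, x⟩ : Σ k, Fin (d k)) = e i
      · have h2 : (⟨k, x⟩ : Σ k, Fin (d k)) ≠ e j := by
          rw [h]; exact fun h => hij (e.injective h)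
        rw [key j w k x b h2]; simp
      · rw [key i v k x a h]; simp
    | zero => simp
    | add Y Z _ _ h1 h2 =>
      rw [Matrix.conjTranspose_add, Matrix.add_mul, Matrix.trace_add, h1, h2, add_zero]
    | smul c Y _ h =>
      rw [Matrix.conjTranspose_smul, Matrix.smul_mul, Matrix.trace_smul, h, smul_zero]

theorem indep_bound {K : ℕ} (d m : Fin K → ℕ) (M : ℕ)
    (ρ : Fin M → Matrix (BlockIdx d m) (BlockIdx d m) ℂ)
    (h : IsIndepFamily (blockAlgebra d m) ρ) : M ≤ ∑ k, d k := by
  classical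
  obtain ⟨hs, ho⟩ := h
  have hne : ∀ i, ∃ v : BlockIdx d m → ℂ, v ∈ Set.range (ρ i).mulVec ∧
      ∃ (k : Fin K) (a : Fin (m k)) (x : Fin (d k)), v ⟨k, x, a⟩ ≠ 0 := by
    intro i
    by_contra hc
    push Not at hc
    have h0 : ρ i = 0 := by
      ext ⟨k, x, a⟩ q
      have := hc _ ⟨Pi.single q 1, rfl⟩ k a x
      simpa using this
    have := (hs i).2
    rw [h0] at this
    simp at this
  choose v hv k a x hx using hne
  let u : Fin M → EuclideanSpace ℂ (Σ k, Fin (d k)) := fun i =>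
    WithLp.toLp 2 (fun s => if hk : s.1 = k i then v i ⟨s.1, s.2, Fin.cast (congrArg m hk.symm) (a i)⟩ else 0)
  have hu0 : ∀ i, u i ≠ 0 := by
    intro i h0
    have := congrArg (fun f : EuclideanSpace ℂ (Σ k, Fin (d k)) => f ⟨k i, x i⟩) h0
    apply hx i
    simpa [u] using this
  have hin : ∀ i j, i ≠ j → inner ℂ (u i) (u j) = 0 := by
    intro i j hij
    rw [PiLp.inner_apply]
    by_cases hk : k i = k j
    · have key : ∀ (l : Fin K) (b c : Fin (m l)),
          ∑ y, v j ⟨l, y, b⟩ * star (v i ⟨l, y, c⟩) = 0 := by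
        intro l b c
        have := ho j i hij.symm _ (hv j) _ (hv i) (blockMatrix d m l (Matrix.single b c 1))
          (Submodule.subset_span ⟨l, _, rfl⟩)
        rw [block_trace] at this
        rw [← this]
        refine Finset.sum_congr rfl fun y _ => ?_
        rw [Finset.sum_eq_single c, Finset.sum_eq_single b]
        · simp
        · intro b' _ hb
          simp [Matrix.single_apply, hb.symm]
        · simp
        · intro c' _ hc
          simp [Matrix.single_apply, hc.symm]
        · simp
      rw [Fintype.sum_sigma, Finset.sum_eq_single (k i)]
      · have := key (k i) (Fin.cast (congrArg m hk.symm) (a j)) (a i)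
        rw [← this]
        refine Finset.sum_congr rfl fun y _ => ?_
        simp [u, hk, RCLike.inner_apply]
      · intro l _ hl
        simp [u, hl]
      · simp
    · refine Finset.sum_eq_zero fun s _ => ?_
      by_cases h1 : s.1 = k i
      · have : s.1 ≠ k j := h1 ▸ hk
        simp [u, this]
      · simp [u, h1]
  have hli : LinearIndependent ℂ u :=
    linearIndependent_of_ne_zero_of_inner_eq_zero hu0 (fun i j hij => hin i j hij)
  have := hli.fintype_card_le_finrank
  simpa using this


/-- The independence number of the block *-algebra `⊕ₖ (1_{d k} ⊗ M_{m k}(ℂ))` is `∑ₖ d k`: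
there is an independent family of that size, and no larger one. -/
theorem indepNumber_blockAlgebra
    (K : ℕ) (hK : 1 ≤ K) (d m : Fin K → ℕ) (hd : ∀ k, 1 ≤ d k) (hm : ∀ k, 1 ≤ m k) :
    (∃ ρ : Fin (∑ k, d k) → Matrix (BlockIdx d m) (BlockIdx d m) ℂ,
      IsIndepFamily (blockAlgebra d m) ρ) ∧
    (∀ (M : ℕ) (ρ : Fin M → Matrix (BlockIdx d m) (BlockIdx d m) ℂ),
      IsIndepFamily (blockAlgebra d m) ρ → M ≤ ∑ k, d k) := by
  exact ⟨indep_exists d m hm, fun M ρ h => indep_bound d m M ρ h⟩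
end

section
/- Let S ⊆ Matrix ι ι ℂ be the block *-algebra ⊕_k (1_{d k} ⊗ M_{m k}(ℂ)) of the context. Then the quantum independence number of S equals max_k d k; that is: (i) there exists P : Matrix ι ι ℂ with Pᴴ = P, P * P = P, trace P = max_k d k, such that for every Y ∈ S there is c : ℂ with P * Y * P = c • P, and (ii) for every P : Matrix ι ι ℂ with Pᴴ = P, P * P = P and the property that for every Y ∈ S there is c : ℂ with P * Y * P = c • P, one has Re (trace P) ≤ max_k d k. (Part of the paper's Lemma computing the independence numbers of *-algebras: α_q(S) = max_k d_k.) -/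
open Matrix Kronecker ComplexOrder

/-- indicator weight of the slice `(k, a)` -/
def sliceW {K : ℕ} (d m : Fin K → ℕ) (k : Fin K) (a : Fin (m k)) : BlockIdx d m → ℂ :=
  fun p => if p.1 = k ∧ p.2.2.val = a.val then 1 else 0

theorem sliceW_eq {K : ℕ} (d m : Fin K → ℕ) (k : Fin K) (a : Fin (m k)) :
    blockMatrix d m k (Matrix.single a a 1) = Matrix.diagonal (sliceW d m k a) := by
  ext ⟨k1, i, x⟩ ⟨k2, j, y⟩
  by_cases h1 : k1 = k
  · subst h1
    by_cases h2 : k2 = k1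
    · subst h2
      simp only [blockMatrix, sliceW, Matrix.diagonal_apply, Matrix.single_apply, Sigma.mk.injEq,
        heq_eq_eq, Prod.mk.injEq, true_and, dite_true, Fin.cast_eq_self, Fin.ext_iff]
      split_ifs <;> first | rfl | (exfalso; omega)
    · have : k1 ≠ k2 := fun h => h2 h.symm
      simp [blockMatrix, sliceW, Matrix.diagonal_apply, h2, this]
  · simp [blockMatrix, sliceW, Matrix.diagonal_apply, h1]

theorem sliceW_sum {K : ℕ} (d m : Fin K → ℕ) :
    ∑ k, ∑ a, Matrix.diagonal (sliceW d m k a) = 1 := by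
  have : ∀ p : BlockIdx d m, ∑ k, ∑ a, sliceW d m k a p = 1 := by
    rintro ⟨k1, i, x⟩
    rw [Finset.sum_eq_single k1]
    · simp [sliceW, ← Fin.ext_iff]
    · intro b _ hb
      simp [sliceW, Ne.symm hb]
    · simp
  ext p q
  simp only [Matrix.sum_apply, Matrix.diagonal_apply, Matrix.one_apply]
  by_cases h : p = q
  · simp [h, this]
  · simp [h]

theorem sliceW_trace {K : ℕ} (d m : Fin K → ℕ) (k : Fin K) (a : Fin (m k)) :
    ∑ p, sliceW d m k a p = (d k : ℂ) := by
  rw [Fintype.sum_sigma, Finset.sum_eq_single k]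
  · rw [Fintype.sum_prod_type]
    simp [sliceW, ← Fin.ext_iff]
  · intro b _ hb
    simp [sliceW, hb]
  · simp

theorem proj_trace_rank {n : Type*} [Fintype n] [DecidableEq n] (P : Matrix n n ℂ)
    (h : P * P = P) : P.trace = (P.rank : ℂ) := by
  have hp : LinearMap.IsProj (LinearMap.range (Matrix.toLin' P)) (Matrix.toLin' P) := by
    refine ⟨fun x => ⟨x, rfl⟩, ?_⟩
    rintro _ ⟨x, rfl⟩
    simp only [Matrix.toLin'_apply, Matrix.mulVec_mulVec, h]
  have := hp.trace
  rw [Matrix.trace_toLin'_eq] at this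
  exact this

theorem sliceW_idem {K : ℕ} (d m : Fin K → ℕ) (k : Fin K) (a : Fin (m k)) :
    Matrix.diagonal (sliceW d m k a) * Matrix.diagonal (sliceW d m k a) =
      Matrix.diagonal (sliceW d m k a) := by
  rw [Matrix.diagonal_mul_diagonal]
  congr 1; ext p; simp [sliceW]

theorem sliceW_KL {K : ℕ} (d m : Fin K → ℕ) (k : Fin K) (a : Fin (m k)) :
    IsKLProjection (blockAlgebra d m) (Matrix.diagonal (sliceW d m k a)) := by
  refine ⟨?_, sliceW_idem d m k a, ?_⟩
  · rw [Matrix.diagonal_conjTranspose]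
    congr 1; ext p; simp only [sliceW, Pi.star_apply]; split_ifs <;> simp
  · intro Y hY
    induction hY using Submodule.span_induction with
    | mem Y h =>
      obtain ⟨l, B, rfl⟩ := h
      by_cases hl : l = k
      · subst hl
        refine ⟨B a a, ?_⟩
        ext ⟨k1, i, x⟩ ⟨k2, j, y⟩
        rw [Matrix.mul_diagonal, Matrix.diagonal_mul, Matrix.smul_apply, Matrix.diagonal_apply]
        by_cases h1 : k1 = l
        · subst h1
          by_cases h2 : k2 = k1
          · subst h2
            by_cases hx : x = a
            · by_cases hy : y = a
              · subst hx; subst hy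
                simp [sliceW, blockMatrix]
              · have hy' : y.val ≠ a.val := fun h => hy (Fin.ext h)
                subst hx
                simp [sliceW, hy', Ne.symm hy]
            · have hx' : x.val ≠ a.val := fun h => hx (Fin.ext h)
              simp [sliceW, hx']
          · simp [sliceW, h2, Ne.symm h2]
        · simp [sliceW, h1]
      · refine ⟨0, ?_⟩
        ext ⟨k1, i, x⟩ ⟨k2, j, y⟩
        rw [Matrix.mul_diagonal, Matrix.diagonal_mul]
        by_cases h1 : k1 = k
        · subst h1
          simp [blockMatrix, Ne.symm hl]
        · simp [sliceW, h1]
    | zero => exact ⟨0, by simp⟩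
    | add x y _ _ hx hy =>
      obtain ⟨c, hc⟩ := hx
      obtain ⟨e, he⟩ := hy
      exact ⟨c + e, by rw [mul_add, add_mul, hc, he, add_smul]⟩
    | smul r x _ hx =>
      obtain ⟨c, hc⟩ := hx
      exact ⟨r * c, by rw [Matrix.mul_smul, Matrix.smul_mul, hc, smul_smul]⟩

/-- The quantum independence number of the block *-algebra `⊕ₖ (1_{d k} ⊗ M_{m k}(ℂ))` is
`maxₖ d k`: there is a Knill–Laflamme projection of that trace, and every Knill–Laflamme
projection has trace at most `maxₖ d k`. -/
theorem quantumIndepNumber_blockAlgebra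
    (K : ℕ) (hK : 1 ≤ K) (d m : Fin K → ℕ) (hd : ∀ k, 1 ≤ d k) (hm : ∀ k, 1 ≤ m k) :
    (∃ P : Matrix (BlockIdx d m) (BlockIdx d m) ℂ,
      IsKLProjection (blockAlgebra d m) P ∧ P.trace = ((Finset.univ.sup d : ℕ) : ℂ)) ∧
    (∀ P : Matrix (BlockIdx d m) (BlockIdx d m) ℂ,
      IsKLProjection (blockAlgebra d m) P → (P.trace).re ≤ ((Finset.univ.sup d : ℕ) : ℝ)) := by
  have : Nonempty (Fin K) := ⟨⟨0, hK⟩⟩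
  constructor
  · obtain ⟨k, -, hk⟩ := Finset.exists_mem_eq_sup Finset.univ Finset.univ_nonempty d
    refine ⟨Matrix.diagonal (sliceW d m k ⟨0, hm k⟩), sliceW_KL d m k _, ?_⟩
    rw [Matrix.trace_diagonal, sliceW_trace, hk]
  · rintro P ⟨-, hP, hS⟩
    by_cases h0 : P = 0
    · simp [h0]
    have hc : ∃ k, ∃ a : Fin (m k), P * Matrix.diagonal (sliceW d m k a) * P ≠ 0 := by
      by_contra! hcon
      apply h0
      calc P = P * 1 * P := by rw [mul_one, hP]
        _ = 0 := by
          rw [← sliceW_sum d m]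
          simp only [Finset.mul_sum, Finset.sum_mul, hcon, Finset.sum_const_zero]
    obtain ⟨k, a, hka⟩ := hc
    obtain ⟨c, hc⟩ := hS (Matrix.diagonal (sliceW d m k a))
      (Submodule.subset_span ⟨k, Matrix.single a a 1, (sliceW_eq d m k a).symm⟩)
    have hc0 : c ≠ 0 := by
      rintro rfl
      exact hka (by rw [hc, zero_smul])
    have hr : P.rank ≤ (Matrix.diagonal (sliceW d m k a)).rank := by
      rw [← Matrix.rank_smul_of_mem_nonZeroDivisors P (mem_nonZeroDivisors_of_ne_zero hc0), ← hc]
      exact (Matrix.rank_mul_le_left _ _).trans (Matrix.rank_mul_le_right _ _)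
    have hs : (Matrix.diagonal (sliceW d m k a)).rank = d k := by
      have := proj_trace_rank _ (sliceW_idem d m k a)
      rw [Matrix.trace_diagonal, sliceW_trace] at this
      exact_mod_cast this.symm
    rw [proj_trace_rank P hP, Complex.natCast_re]
    exact_mod_cast (hr.trans hs.le).trans (Finset.le_sup (f := d) (Finset.mem_univ k))
end

section
/- Let S ⊆ Matrix ι ι ℂ and T ⊆ Matrix ι' ι' ℂ be block *-algebras as in the context, with block data (d, m) over Fin K and (d', m') over Fin K' respectively, and let S ⊗ T ⊆ Matrix (ι × ι') (ι × ι') ℂ denote the ℂ-linear span of the Kronecker products A ⊗ₖ B with A ∈ S and B ∈ T. Then the independence numbers are multiplicative: the largest independent family for S ⊗ T has size (∑_k d k) * (∑_j d' j) = α(S) * α(T); the largest private independent family for S ⊗ T has size (max_k d k) * (max_j d' j) = α_p(S) * α_p(T); the largest Knill–Laflamme projection for S ⊗ T has trace (max_k d k) * (max_j d' j) = α_q(S) * α_q(T); and the largest entanglement-assisted independent family for S ⊗ T has size (∑_k (d k)²) * (∑_j (d' j)²) = α_ea(S) * α_ea(T). (Multiplicativity part of the paper's Lemma on independence numbers of *-algebras.)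 -/
open Matrix Kronecker ComplexOrder

/-- The span of Kronecker products `A ⊗ₖ B` with `A ∈ S`, `B ∈ T`. -/
noncomputable def tensorSpan {ι ι' : Type*} [Fintype ι] [Fintype ι']
    (S : Submodule ℂ (Matrix ι ι ℂ)) (T : Submodule ℂ (Matrix ι' ι' ℂ)) :
    Submodule ℂ (Matrix (ι × ι') (ι × ι') ℂ) :=
  Submodule.span ℂ {Z | ∃ A ∈ S, ∃ B ∈ T, Z = A ⊗ₖ B}


/-- Abstract block data: an equivalence of the index type with a sigma type, with `S` of block form. -/
structure BlockData {X : Type} [Fintype X] [DecidableEq X] (D E : X → Type)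
    [∀ x, Fintype (D x)] [∀ x, DecidableEq (D x)] [∀ x, Fintype (E x)] [∀ x, DecidableEq (E x)]
    {ι : Type} [Fintype ι] [DecidableEq ι] (S : Submodule ℂ (Matrix ι ι ℂ)) where
  f : ((x : X) × (D x × E x)) ≃ ι
  unit_mem : ∀ x a b, (∑ l : D x, Matrix.single (f ⟨x, l, a⟩) (f ⟨x, l, b⟩) (1 : ℂ)) ∈ S
  off : ∀ Y ∈ S, ∀ x y (_ : x ≠ y) l l' a b, Y (f ⟨x, l, a⟩) (f ⟨y, l', b⟩) = 0
  offd : ∀ Y ∈ S, ∀ x l l' (_ : l ≠ l') a b, Y (f ⟨x, l, a⟩) (f ⟨x, l', b⟩) = 0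
  const : ∀ Y ∈ S, ∀ x l l' a b, Y (f ⟨x, l, a⟩) (f ⟨x, l, b⟩) = Y (f ⟨x, l', a⟩) (f ⟨x, l', b⟩)

section core

set_option linter.unusedSectionVars false

variable {X : Type} [Fintype X] [DecidableEq X] {D E : X → Type}
    [∀ x, Fintype (D x)] [∀ x, DecidableEq (D x)] [∀ x, Fintype (E x)] [∀ x, DecidableEq (E x)]
    {ι : Type} [Fintype ι] [DecidableEq ι] {S : Submodule ℂ (Matrix ι ι ℂ)}

lemma trace_conj_mul (Y M : Matrix ι ι ℂ) :
    Matrix.trace (Yᴴ * M) = ∑ p, ∑ q, star (Y p q) * M p q := by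
  simp only [Matrix.trace, Matrix.diag, Matrix.mul_apply, Matrix.conjTranspose_apply]
  rw [Finset.sum_comm]

lemma BlockData.sum_eq {A : Type} [AddCommMonoid A] (B : BlockData D E S) (g : ι → A) :
    ∑ p, g p = ∑ x, ∑ l, ∑ a, g (B.f ⟨x, l, a⟩) := by
  rw [← B.f.sum_comp, Fintype.sum_sigma]
  simp only [Fintype.sum_prod_type]

lemma BlockData.trace_unit (B : BlockData D E S) (x : X) (a b : E x) (M : Matrix ι ι ℂ) :
    Matrix.trace ((∑ l : D x, Matrix.single (B.f ⟨x, l, a⟩) (B.f ⟨x, l, b⟩) (1 : ℂ))ᴴ * M)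
      = ∑ l, M (B.f ⟨x, l, a⟩) (B.f ⟨x, l, b⟩) := by
  simp [Matrix.conjTranspose_sum, Finset.sum_mul, Matrix.trace_sum, Matrix.trace_single_mul]

lemma BlockData.orth (B : BlockData D E S) (M : Matrix ι ι ℂ) :
    (∀ Y ∈ S, Matrix.trace (Yᴴ * M) = 0) ↔
      ∀ x a b, ∑ l, M (B.f ⟨x, l, a⟩) (B.f ⟨x, l, b⟩) = 0 := by
  constructor
  · intro h x a b
    rw [← B.trace_unit]
    exact h _ (B.unit_mem x a b)
  · intro h Y hY
    rw [trace_conj_mul, B.sum_eq]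
    apply Finset.sum_eq_zero
    intro x _
    have h1 : ∀ l a, ∑ q, star (Y (B.f ⟨x, l, a⟩) q) * M (B.f ⟨x, l, a⟩) q
        = ∑ b, star (Y (B.f ⟨x, l, a⟩) (B.f ⟨x, l, b⟩)) * M (B.f ⟨x, l, a⟩) (B.f ⟨x, l, b⟩) := by
      intro l a
      rw [B.sum_eq, Finset.sum_eq_single x, Finset.sum_eq_single l]
      · intro l' _ hl
        apply Finset.sum_eq_zero
        intro b _
        rw [B.offd Y hY x l l' hl.symm]; simp
      · simp
      · intro y _ hy
        apply Finset.sum_eq_zero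
        intro l' _
        apply Finset.sum_eq_zero
        intro b _
        rw [B.off Y hY x y hy.symm]; simp
      · simp
    simp only [h1]
    rw [Finset.sum_comm]
    apply Finset.sum_eq_zero
    intro a _
    rw [Finset.sum_comm]
    apply Finset.sum_eq_zero
    intro b _
    by_cases hD : Nonempty (D x)
    · obtain ⟨l0⟩ := hD
      rw [Finset.sum_congr rfl (fun l _ => by rw [B.const Y hY x l l0 a b]), ← Finset.mul_sum, h x a b,
        mul_zero]
    · rw [not_nonempty_iff] at hD
      simp

lemma BlockData.orthW (B : BlockData D E S) {r : Type} [Fintype r] [DecidableEq r]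
    (M : Matrix (ι × r) (ι × r) ℂ) :
    (∀ Y ∈ S, ∀ W : Matrix r r ℂ, Matrix.trace ((Y ⊗ₖ W)ᴴ * M) = 0) ↔
      ∀ x a b s t, ∑ l, M (B.f ⟨x, l, a⟩, s) (B.f ⟨x, l, b⟩, t) = 0 := by
  have key : ∀ (Y : Matrix ι ι ℂ) (W : Matrix r r ℂ), Matrix.trace ((Y ⊗ₖ W)ᴴ * M)
      = Matrix.trace (Yᴴ * Matrix.of (fun p q => ∑ s, ∑ t, star (W s t) * M (p, s) (q, t))) := by
    intro Y W
    rw [trace_conj_mul, trace_conj_mul]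
    simp only [Fintype.sum_prod_type, Matrix.kroneckerMap_apply, Matrix.of_apply, Finset.mul_sum]
    refine Finset.sum_congr rfl fun p _ => ?_
    rw [Finset.sum_comm]
    refine Finset.sum_congr rfl fun q _ => ?_
    refine Finset.sum_congr rfl fun s _ => ?_
    refine Finset.sum_congr rfl fun t _ => ?_
    rw [star_mul']; ring
  constructor
  · intro h x a b s t
    have h2 := (B.orth _).1 (fun Y hY => (key Y (Matrix.single s t 1)) ▸ h Y hY (Matrix.single s t 1)) x a b
    rw [← h2]
    refine Finset.sum_congr rfl fun l _ => ?_
    rw [Matrix.of_apply, Finset.sum_eq_single s, Finset.sum_eq_single t]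
    · simp
    · intro t' _ ht; simp [ht.symm]
    · simp
    · intro s' _ hs; simp [hs.symm]
    · simp
  · intro h Y hY W
    rw [key]
    refine (B.orth _).2 ?_ Y hY
    intro x a b
    simp only [Matrix.of_apply]
    rw [Finset.sum_comm]
    apply Finset.sum_eq_zero
    intro s _
    rw [Finset.sum_comm]
    apply Finset.sum_eq_zero
    intro t _
    rw [← Finset.mul_sum, h, mul_zero]

/-- pairwise orthogonal nonzero vectors are at most as many as the dimension. -/
lemma card_le_of_orth {H : Type} [Fintype H] {M : ℕ} (u : Fin M → H → ℂ) (h0 : ∀ i, u i ≠ 0)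
    (ho : ∀ i j, i ≠ j → ∑ h, u i h * star (u j h) = 0) : M ≤ Fintype.card H := by
  have hli : LinearIndependent ℂ (fun i => WithLp.toLp 2 (u i) : Fin M → EuclideanSpace ℂ H) := by
    apply linearIndependent_of_ne_zero_of_inner_eq_zero
    · intro i hi
      apply h0 i
      simpa using hi
    · intro i j hij
      simp only [PiLp.inner_apply, RCLike.inner_apply]
      exact ho j i hij.symm
  simpa using hli.fintype_card_le_finrank

lemma BlockData.indep_orth (B : BlockData D E S) {M : ℕ} {ρ : Fin M → Matrix ι ι ℂ}
    (h : IsIndepFamily S ρ) {i j : Fin M} (hij : i ≠ j) (v w : ι → ℂ)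
    (x : X) (a b : E x) :
    ∑ l, (ρ i *ᵥ v) (B.f ⟨x, l, a⟩) * star ((ρ j *ᵥ w) (B.f ⟨x, l, b⟩)) = 0 := by
  have := (B.orth _).1 (fun Y hY => h.2 i j hij _ ⟨v, rfl⟩ _ ⟨w, rfl⟩ Y hY) x a b
  simpa [Matrix.vecMulVec_apply] using this

lemma BlockData.exists_diag (B : BlockData D E S) {ρ : Matrix ι ι ℂ} (h : IsState ρ) :
    ∃ x a, ∑ l, ρ (B.f ⟨x, l, a⟩) (B.f ⟨x, l, a⟩) ≠ 0 := by
  by_contra! hc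
  have h1 := h.2
  rw [Matrix.trace, B.sum_eq] at h1
  simp only [Matrix.diag] at h1
  rw [Finset.sum_eq_zero] at h1
  · simp at h1
  · intro x _
    rw [Finset.sum_comm]
    exact Finset.sum_eq_zero fun a _ => hc x a

lemma BlockData.alpha_le (B : BlockData D E S) {M : ℕ} {ρ : Fin M → Matrix ι ι ℂ}
    (h : IsIndepFamily S ρ) : M ≤ ∑ x, Fintype.card (D x) := by
  have h1 : ∀ i, ∃ x, ∃ l : D x, ∃ a : E x, ρ i (B.f ⟨x, l, a⟩) (B.f ⟨x, l, a⟩) ≠ 0 := by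
    intro i
    obtain ⟨x, a, hx⟩ := B.exists_diag (h.1 i)
    obtain ⟨l, -, hl⟩ := Finset.exists_ne_zero_of_sum_ne_zero hx
    exact ⟨x, l, a, hl⟩
  choose x l a hne using h1
  let v : Fin M → ι → ℂ := fun i => ρ i *ᵥ Pi.single (B.f ⟨x i, l i, a i⟩) 1
  have key := card_le_of_orth (H := (x : X) × D x)
    (fun i p => if h : p.1 = x i then v i (B.f ⟨p.1, p.2, h ▸ a i⟩) else 0) ?_ ?_
  · simpa using key
  · intro i h0
    have := congrFun h0 ⟨x i, l i⟩
    simp [v] at this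
    exact hne i this
  · intro i j hij
    rw [Fintype.sum_sigma]
    apply Finset.sum_eq_zero
    intro y _
    by_cases hi : y = x i
    · by_cases hj : y = x j
      · have := B.indep_orth h hij (Pi.single (B.f ⟨x i, l i, a i⟩) 1)
          (Pi.single (B.f ⟨x j, l j, a j⟩) 1) y (hi ▸ a i) (hj ▸ a j)
        rw [← this]
        refine Finset.sum_congr rfl fun l _ => ?_
        rw [dif_pos hi, dif_pos hj]
      · simp [hj]
    · simp [hi]

lemma BlockData.alphap_le (B : BlockData D E S) {M : ℕ} {ρ : Fin M → Matrix ι ι ℂ}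
    (h : IsPrivateIndepFamily S ρ) (N : ℕ) (hN : ∀ x, Fintype.card (D x) ≤ N) : M ≤ N := by
  rcases Nat.eq_zero_or_pos M with rfl | hM
  · simp
  obtain ⟨x, a, hx⟩ := B.exists_diag (h.1.1 ⟨0, hM⟩)
  have h1 : ∀ i, ∃ l : D x, ρ i (B.f ⟨x, l, a⟩) (B.f ⟨x, l, a⟩) ≠ 0 := by
    intro i
    have : ∑ l, ρ i (B.f ⟨x, l, a⟩) (B.f ⟨x, l, a⟩) ≠ 0 := by
      by_cases hi : i = ⟨0, hM⟩
      · rw [hi]; exact hx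
      · have := (B.orth _).1 (h.2 i ⟨0, hM⟩ hi) x a a
        simp only [Matrix.sub_apply, Finset.sum_sub_distrib] at this
        rw [sub_eq_zero.1 this]; exact hx
    obtain ⟨l, -, hl⟩ := Finset.exists_ne_zero_of_sum_ne_zero this
    exact ⟨l, hl⟩
  choose l hne using h1
  refine le_trans ?_ (hN x)
  apply card_le_of_orth
    (fun i p => (ρ i *ᵥ Pi.single (B.f ⟨x, l i, a⟩) 1) (B.f ⟨x, p, a⟩))
  · intro i h0
    have := congrFun h0 (l i)
    simp at this
    exact hne i this
  · intro i j hij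
    exact B.indep_orth h.1 hij _ _ x a a

lemma BlockData.sum_unit (B : BlockData D E S) :
    ∑ x, ∑ a, ∑ l : D x, Matrix.single (B.f ⟨x, l, a⟩) (B.f ⟨x, l, a⟩) (1 : ℂ) = 1 := by
  have : (1 : Matrix ι ι ℂ) = ∑ p, Matrix.single p p (1 : ℂ) := by
    ext i j
    simp only [Matrix.sum_apply, Matrix.single_apply, Matrix.one_apply]
    rw [Finset.sum_eq_single i] <;> aesop
  rw [this, ← B.f.sum_comp, Fintype.sum_sigma]
  simp only [Fintype.sum_prod_type]
  refine Finset.sum_congr rfl fun x _ => Finset.sum_comm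

lemma trace_proj (P : Matrix ι ι ℂ) (h : P * P = P) : P.trace = (P.rank : ℂ) := by
  have hi : IsIdempotentElem (Matrix.toLin' P) := by
    unfold IsIdempotentElem
    rw [Module.End.mul_eq_comp, ← Matrix.toLin'_mul, h]
  have h2 := (LinearMap.IsIdempotentElem.isProj_range _ hi).trace
  rw [Matrix.trace_toLin'_eq] at h2
  rw [h2]
  rfl

lemma BlockData.alphaq_le (B : BlockData D E S) {P : Matrix ι ι ℂ}
    (h : IsKLProjection S P) (N : ℕ) (hN : ∀ x, Fintype.card (D x) ≤ N) : P.trace.re ≤ (N : ℝ) := by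
  rw [trace_proj P h.2.1]
  simp only [Complex.natCast_re, Nat.cast_le]
  by_cases hP : P = 0
  · simp [hP]
  choose c hc using fun x a => h.2.2 _ (B.unit_mem x a a)
  have : ∃ x a, c x a ≠ 0 := by
    by_contra! h0
    apply hP
    have h2 : P * 1 * P = P := by rw [mul_one, h.2.1]
    rw [← B.sum_unit] at h2
    rw [← h2]
    simp only [Finset.mul_sum, Finset.sum_mul]
    apply Finset.sum_eq_zero
    intro x _
    apply Finset.sum_eq_zero
    intro a _
    have := hc x a
    simp only [Finset.mul_sum, Finset.sum_mul, h0, zero_smul] at this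
    exact this
  obtain ⟨x, a, hxa⟩ := this
  refine le_trans ?_ (hN x)
  let A : Matrix ι (D x) ℂ := Matrix.of fun p l => if p = B.f ⟨x, l, a⟩ then 1 else 0
  have hA : (∑ l : D x, Matrix.single (B.f ⟨x, l, a⟩) (B.f ⟨x, l, a⟩) (1 : ℂ)) = A * Aᵀ := by
    ext p q
    simp only [Matrix.sum_apply, Matrix.mul_apply, Matrix.transpose_apply, A, Matrix.of_apply,
      Matrix.single_apply]
    refine Finset.sum_congr rfl fun l _ => ?_
    by_cases h1 : p = B.f ⟨x, l, a⟩ <;> by_cases h2 : q = B.f ⟨x, l, a⟩ <;>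
      simp [h1, h2, Ne.symm]
  have hr : P = ((c x a)⁻¹ • (P * A)) * (Aᵀ * P) := by
    have := hc x a
    rw [hA] at this
    rw [Matrix.smul_mul, ← Matrix.mul_assoc, Matrix.mul_assoc P A, this, smul_smul,
      inv_mul_cancel₀ hxa, one_smul]
  rw [hr]
  exact (Matrix.rank_mul_le_left _ _).trans (Matrix.rank_le_card_width _)

lemma BlockData.indep_constr (B : BlockData D E S) (a0 : ∀ x, E x) {M : ℕ}
    (e : Fin M → (x : X) × D x) (he : Function.Injective e) :
    IsIndepFamily S (fun i => Matrix.single (B.f ⟨(e i).1, (e i).2, a0 _⟩)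
      (B.f ⟨(e i).1, (e i).2, a0 _⟩) (1 : ℂ)) := by
  refine ⟨fun i => ⟨?_, by simp⟩, ?_⟩
  · beta_reduce
    rw [← Matrix.diagonal_single]
    apply Matrix.PosSemidef.diagonal
    intro j
    by_cases h : j = B.f ⟨(e i).1, (e i).2, a0 _⟩
    · subst h; simp
    · simp [h]
  · rintro i j hij _ ⟨v, rfl⟩ _ ⟨w, rfl⟩
    refine (B.orth _).2 ?_
    intro x a b
    apply Finset.sum_eq_zero
    intro l _
    simp only [Matrix.vecMulVec_apply, Matrix.single_mulVec, Pi.star_apply]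
    by_cases h1 : B.f ⟨x, l, a⟩ = B.f ⟨(e i).1, (e i).2, a0 _⟩
    · by_cases h2 : B.f ⟨x, l, b⟩ = B.f ⟨(e j).1, (e j).2, a0 _⟩
      · exfalso
        apply hij
        apply he
        have h1 := B.f.injective h1
        have h2 := B.f.injective h2
        have h3 : (⟨x, l⟩ : (x : X) × D x) = e i :=
          congrArg (fun p : (x : X) × (D x × E x) => (⟨p.1, p.2.1⟩ : (x : X) × D x)) h1
        have h4 : (⟨x, l⟩ : (x : X) × D x) = e j :=
          congrArg (fun p : (x : X) × (D x × E x) => (⟨p.1, p.2.1⟩ : (x : X) × D x)) h2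
        rw [← h3, ← h4]
      · simp [Function.update_of_ne h2]
    · simp [Function.update_of_ne h1]

lemma BlockData.alpha_ge (B : BlockData D E S) (a0 : ∀ x, E x) (M : ℕ)
    (hM : M = ∑ x, Fintype.card (D x)) : ∃ ρ : Fin M → Matrix ι ι ℂ, IsIndepFamily S ρ := by
  have e : Fin M ≃ (x : X) × D x := Fintype.equivOfCardEq (by simp [hM])
  exact ⟨_, B.indep_constr a0 e e.injective⟩

lemma BlockData.alphap_ge (B : BlockData D E S) (a0 : ∀ x, E x) (M : ℕ) (x : X)
    (hM : M = Fintype.card (D x)) : ∃ ρ : Fin M → Matrix ι ι ℂ, IsPrivateIndepFamily S ρ := by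
  have e : Fin M ≃ D x := Fintype.equivOfCardEq (by simp [hM])
  refine ⟨_, B.indep_constr a0 (fun i => ⟨x, e i⟩) ?_, ?_⟩
  · intro i j h
    simpa using h
  · intro i j _ Y hY
    simp only [mul_sub, Matrix.trace_sub, Matrix.trace_mul_single]
    simp [B.const Y hY x (e i) (e j)]

lemma BlockData.alphaq_ge (B : BlockData D E S) (a0 : ∀ x, E x) (M : ℕ) (x : X)
    (hM : M = Fintype.card (D x)) :
    ∃ P : Matrix ι ι ℂ, IsKLProjection S P ∧ P.trace = (M : ℂ) := by
  classical
  let P : Matrix ι ι ℂ := Matrix.diagonal fun p => if ∃ l, p = B.f ⟨x, l, a0 x⟩ then 1 else 0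
  have hinj : Function.Injective fun l => B.f ⟨x, l, a0 x⟩ := by
    intro l l' h
    have := B.f.injective h
    simpa using this
  refine ⟨P, ⟨?_, ?_, ?_⟩, ?_⟩
  · simp only [P, Matrix.diagonal_conjTranspose]
    congr 1
    ext p
    simp only [Pi.star_apply]
    split_ifs <;> simp
  · simp only [P, Matrix.diagonal_mul_diagonal]
    congr 1
    ext p
    split_ifs <;> simp
  · intro Y hY
    by_cases hD : Nonempty (D x)
    · obtain ⟨l0⟩ := hD
      refine ⟨Y (B.f ⟨x, l0, a0 x⟩) (B.f ⟨x, l0, a0 x⟩), ?_⟩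
      ext p q
      simp only [P, Matrix.mul_diagonal, Matrix.diagonal_mul, Matrix.smul_apply, Matrix.diagonal_apply]
      by_cases hp : ∃ l, p = B.f ⟨x, l, a0 x⟩
      · by_cases hq : ∃ l, q = B.f ⟨x, l, a0 x⟩
        · rw [if_pos hp, if_pos hq]
          obtain ⟨l, rfl⟩ := hp
          obtain ⟨l', rfl⟩ := hq
          by_cases hl : l = l'
          · subst hl
            simp [B.const Y hY x l l0]
          · rw [B.offd Y hY x l l' hl, if_neg (fun h => hl (hinj h))]; simp
        · have hpq : p ≠ q := by
            rintro rfl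
            exact hq hp
          rw [if_neg hq, if_neg hpq]
          simp
      · simp [hp]
    · rw [not_nonempty_iff] at hD
      refine ⟨0, ?_⟩
      have : P = 0 := by
        ext p q
        simp [P]
      simp [this]
  · simp only [P, Matrix.trace_diagonal]
    rw [Finset.sum_boole, hM]
    norm_cast
    rw [← Finset.card_univ, ← Finset.card_image_of_injective Finset.univ hinj]
    congr 1
    ext p
    simp [eq_comm]


open scoped MatrixOrder Matrix.Norms.L2Operator in
lemma psd_factor {n : ℕ} {ρ : Matrix (Fin n) (Fin n) ℂ} (h : ρ.PosSemidef) :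
    ∃ R : Matrix (Fin n) (Fin n) ℂ, ρ = Rᴴ * R := by
  obtain ⟨B, hB⟩ := CStarAlgebra.nonneg_iff_eq_star_mul_self.mp h.nonneg
  exact ⟨B, hB⟩

lemma frob_eq {m n : Type} [Fintype m] [Fintype n] (A : Matrix m n ℂ) :
    ((∑ p, ∑ q, ‖A p q‖ ^ 2 : ℝ) : ℂ) = Matrix.trace (Aᴴ * A) := by
  simp only [Matrix.trace, Matrix.diag, Matrix.mul_apply, Matrix.conjTranspose_apply]
  rw [Finset.sum_comm]
  push_cast
  refine Finset.sum_congr rfl fun p _ => Finset.sum_congr rfl fun q _ => ?_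
  rw [← Complex.conj_mul']
  rfl

lemma frob_iso {m n k : Type} [Fintype m] [Fintype n] [DecidableEq n] [Fintype k]
    (V : Matrix m n ℂ) (hV : Vᴴ * V = 1) (A : Matrix n k ℂ) :
    ∑ p, ∑ q, ‖(V * A) p q‖ ^ 2 = ∑ p, ∑ q, ‖A p q‖ ^ 2 := by
  have : ((∑ p, ∑ q, ‖(V * A) p q‖ ^ 2 : ℝ) : ℂ) = ((∑ p, ∑ q, ‖A p q‖ ^ 2 : ℝ) : ℂ) := by
    rw [frob_eq, frob_eq, Matrix.conjTranspose_mul, Matrix.mul_assoc, ← Matrix.mul_assoc Vᴴ, hV,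
      Matrix.one_mul]
  exact_mod_cast this

lemma ea_block {D n Q : Type} [Fintype D] [DecidableEq D] [Fintype n] [DecidableEq n] [Fintype Q]
    {M : ℕ} (R : Matrix n n ℂ)
    (hR : ∑ q, ∑ t, ‖R q t‖ ^ 2 = 1) (K : Fin M → Q → Matrix D n ℂ)
    (hK : ∀ i (b : n → ℂ), ∑ κ, ∑ l, ‖∑ q, K i κ l q * b q‖ ^ 2 ≤ ∑ q, ‖b q‖ ^ 2)
    (ho : ∀ i j, i ≠ j → ∀ κ κ', ∑ l, ∑ t, (K i κ * R) l t * star ((K j κ' * R) l t) = 0) :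
    ∑ i, ∑ κ, ∑ l, ∑ t, ‖(K i κ * R) l t‖ ^ 2 ≤ (Fintype.card D : ℝ) ^ 2 := by
  let ψ : Fin M → Q → EuclideanSpace ℂ (D × n) := fun i κ =>
    WithLp.toLp 2 fun p => (K i κ * R) p.1 p.2
  let W : Fin M → Submodule ℂ (EuclideanSpace ℂ (D × n)) := fun i =>
    Submodule.span ℂ (Set.range (ψ i))
  have hW : OrthogonalFamily ℂ (fun i => W i) (fun i => (W i).subtypeₗᵢ) := by
    rw [orthogonalFamily_iff_pairwise]
    intro i j hij
    simp only [Function.onFun, W]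
    rw [Submodule.isOrtho_span]
    rintro _ ⟨κ, rfl⟩ _ ⟨κ', rfl⟩
    simp only [PiLp.inner_apply, RCLike.inner_apply, Fintype.sum_prod_type, ψ]
    exact ho j i hij.symm κ' κ
  let b := fun i => stdOrthonormalBasis ℂ (W i)
  have hb := hW.orthonormal_sigma_orthonormal (v_family := fun i => b i) (fun i => (b i).orthonormal)
  let y : D → n → EuclideanSpace ℂ (D × n) := fun l q =>
    WithLp.toLp 2 fun p => if p.1 = l then R q p.2 else 0
  have hy : ∀ l q, ‖y l q‖ ^ 2 = ∑ t, ‖R q t‖ ^ 2 := by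
    intro l q
    rw [EuclideanSpace.norm_sq_eq, Fintype.sum_prod_type, Finset.sum_eq_single l]
    · simp [y]
    · intro l' _ hl; simp [y, hl]
    · simp
  have hbessel : ∀ l q, ∑ i, ∑ β, ‖inner ℂ ((b i β : W i) : EuclideanSpace ℂ (D × n)) (y l q)‖ ^ 2
      ≤ ∑ t, ‖R q t‖ ^ 2 := by
    intro l q
    have := hb.sum_inner_products_le (y l q) (s := Finset.univ)
    rw [hy, Fintype.sum_sigma] at this
    exact this
  have hin : ∀ (B : EuclideanSpace ℂ (D × n)) i κ,
      inner ℂ B (ψ i κ) = ∑ l, ∑ q, K i κ l q * inner ℂ B (y l q) := by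
    intro B i κ
    simp only [PiLp.inner_apply, RCLike.inner_apply, Fintype.sum_prod_type, ψ, y, Matrix.mul_apply,
      Finset.mul_sum, Finset.sum_mul]
    refine Finset.sum_congr rfl fun l _ => ?_
    rw [Finset.sum_comm]
    refine Finset.sum_congr rfl fun q _ => ?_
    rw [Finset.sum_eq_single l]
    · refine Finset.sum_congr rfl fun t _ => ?_
      simp; ring
    · intro l' _ hl; simp [hl]
    · simp
  have hB : ∀ (B : EuclideanSpace ℂ (D × n)) i,
      ∑ κ, ‖inner ℂ B (ψ i κ)‖ ^ 2 ≤
        Fintype.card D * ∑ l, ∑ q, ‖inner ℂ B (y l q)‖ ^ 2 := by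
    intro B i
    calc ∑ κ, ‖inner ℂ B (ψ i κ)‖ ^ 2
        ≤ ∑ κ, Fintype.card D * ∑ l, ‖∑ q, K i κ l q * inner ℂ B (y l q)‖ ^ 2 := by
          refine Finset.sum_le_sum fun κ _ => ?_
          rw [hin]
          refine le_trans (pow_le_pow_left₀ (norm_nonneg _) (norm_sum_le _ _) 2) ?_
          exact sq_sum_le_card_mul_sum_sq
      _ = Fintype.card D * ∑ l, ∑ κ, ‖∑ q, K i κ l q * inner ℂ B (y l q)‖ ^ 2 := by
          rw [← Finset.mul_sum, Finset.sum_comm]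
      _ ≤ _ := by
          refine mul_le_mul_of_nonneg_left ?_ (by positivity)
          refine Finset.sum_le_sum fun l _ => ?_
          refine le_trans ?_ (hK i fun q => inner ℂ B (y l q))
          refine Finset.sum_le_sum fun κ _ => ?_
          exact Finset.single_le_sum (f := fun l' => ‖∑ q, K i κ l' q * inner ℂ B (y l q)‖ ^ 2)
            (fun _ _ => by positivity) (Finset.mem_univ l)
  have hpars : ∀ i κ, ∑ l, ∑ t, ‖(K i κ * R) l t‖ ^ 2 =
      ∑ β, ‖inner ℂ ((b i β : W i) : EuclideanSpace ℂ (D × n)) (ψ i κ)‖ ^ 2 := by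
    intro i κ
    have hm : ψ i κ ∈ W i := Submodule.subset_span ⟨κ, rfl⟩
    have h1 := (b i).sum_sq_norm_inner_right ⟨ψ i κ, hm⟩
    simp only [Submodule.coe_inner, Submodule.coe_norm] at h1
    rw [h1, EuclideanSpace.norm_sq_eq, Fintype.sum_prod_type]
  calc ∑ i, ∑ κ, ∑ l, ∑ t, ‖(K i κ * R) l t‖ ^ 2
      = ∑ i, ∑ β, ∑ κ, ‖inner ℂ ((b i β : W i) : EuclideanSpace ℂ (D × n)) (ψ i κ)‖ ^ 2 := by
        refine Finset.sum_congr rfl fun i _ => ?_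
        rw [Finset.sum_congr rfl fun κ _ => hpars i κ, Finset.sum_comm]
    _ ≤ ∑ i, ∑ β, Fintype.card D * ∑ l, ∑ q,
          ‖inner ℂ ((b i β : W i) : EuclideanSpace ℂ (D × n)) (y l q)‖ ^ 2 :=
        Finset.sum_le_sum fun i _ => Finset.sum_le_sum fun β _ => hB _ i
    _ = Fintype.card D * ∑ l, ∑ q, ∑ i, ∑ β,
          ‖inner ℂ ((b i β : W i) : EuclideanSpace ℂ (D × n)) (y l q)‖ ^ 2 := by
        simp only [← Finset.mul_sum]
        congr 1
        have h1 : ∀ i, ∑ β, ∑ l, ∑ q,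
            ‖inner ℂ ((b i β : W i) : EuclideanSpace ℂ (D × n)) (y l q)‖ ^ 2 =
            ∑ l, ∑ q, ∑ β, ‖inner ℂ ((b i β : W i) : EuclideanSpace ℂ (D × n)) (y l q)‖ ^ 2 := by
          intro i
          rw [Finset.sum_comm]
          exact Finset.sum_congr rfl fun l _ => Finset.sum_comm
        rw [Finset.sum_congr rfl fun i _ => h1 i, Finset.sum_comm]
        exact Finset.sum_congr rfl fun l _ => Finset.sum_comm
    _ ≤ Fintype.card D * ∑ l : D, ∑ q, ∑ t, ‖R q t‖ ^ 2 := by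
        refine mul_le_mul_of_nonneg_left ?_ (by positivity)
        exact Finset.sum_le_sum fun l _ => Finset.sum_le_sum fun q _ => hbessel l q
    _ = _ := by
        rw [hR]; simp [sq]

lemma BlockData.ea_le (B : BlockData D E S) {M : ℕ} (h : IsEAIndepFamily S M) :
    M ≤ ∑ x, Fintype.card (D x) ^ 2 := by
  obtain ⟨n, r, -, -, ρ, hρ, V, hV, ho⟩ := h
  obtain ⟨R', hR'⟩ := psd_factor hρ.1
  obtain ⟨R, rfl⟩ : ∃ R, R' = Rᴴ := ⟨R'ᴴ, by simp⟩
  rw [Matrix.conjTranspose_conjTranspose] at hR'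
  have hR : ∑ q, ∑ t, ‖R q t‖ ^ 2 = 1 := by
    have h1 := frob_eq R
    rw [Matrix.trace_mul_comm, ← hR', hρ.2] at h1
    exact_mod_cast h1
  let KK : ∀ x, Fin M → E x × Fin r → Matrix (D x) (Fin n) ℂ := fun x i κ =>
    Matrix.of fun l q => V i (B.f ⟨x, l, κ.1⟩, κ.2) q
  have hsum : ∀ (g : ι × Fin r → ℝ), ∑ p, g p =
      ∑ x, ∑ κ : E x × Fin r, ∑ l, g (B.f ⟨x, l, κ.1⟩, κ.2) := by
    intro g
    rw [Fintype.sum_prod_type, B.sum_eq]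
    refine Finset.sum_congr rfl fun x _ => ?_
    rw [Finset.sum_comm, Fintype.sum_prod_type]
    refine Finset.sum_congr rfl fun a _ => ?_
    rw [Finset.sum_comm]
  have hmul : ∀ x i κ l t, (KK x i κ * R) l t = (V i * R) (B.f ⟨x, l, κ.1⟩, κ.2) t := by
    intro x i κ l t
    simp [KK, Matrix.mul_apply]
  have key : ∀ x, ∑ i, ∑ κ, ∑ l, ∑ t, ‖(KK x i κ * R) l t‖ ^ 2 ≤ (Fintype.card (D x) : ℝ) ^ 2 := by
    intro x
    apply ea_block R hR (KK x)
    · intro i b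
      have h1 := frob_iso (V i) (hV i) (Matrix.of fun q (_ : Unit) => b q)
      simp only [Finset.univ_unique, Finset.sum_singleton, Matrix.of_apply] at h1
      rw [← h1, hsum]
      refine le_trans ?_ (Finset.single_le_sum (fun _ _ => by positivity) (Finset.mem_univ x))
      simp [KK, Matrix.mul_apply]
    · intro i j hij κ κ'
      have h1 := (B.orthW _).1 (ho i j hij) x κ.1 κ'.1 κ.2 κ'.2
      rw [← h1]
      refine Finset.sum_congr rfl fun l _ => ?_
      have : V i * ρ * (V j)ᴴ = (V i * R) * (V j * R)ᴴ := by
        rw [hR', Matrix.conjTranspose_mul]; simp only [Matrix.mul_assoc]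
      rw [this, Matrix.mul_apply]
      refine Finset.sum_congr rfl fun t _ => ?_
      rw [hmul, hmul, Matrix.conjTranspose_apply]
  have htot : ∀ i, ∑ x, ∑ κ, ∑ l, ∑ t, ‖(KK x i κ * R) l t‖ ^ 2 = 1 := by
    intro i
    simp only [hmul]
    rw [← hsum (fun p => ∑ t, ‖(V i * R) p t‖ ^ 2), frob_iso _ (hV i), hR]
  have : (M : ℝ) ≤ ∑ x, (Fintype.card (D x) : ℝ) ^ 2 := by
    calc (M : ℝ) = ∑ i : Fin M, ∑ x, ∑ κ, ∑ l, ∑ t, ‖(KK x i κ * R) l t‖ ^ 2 := by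
          simp [htot]
      _ = ∑ x, ∑ i : Fin M, ∑ κ, ∑ l, ∑ t, ‖(KK x i κ * R) l t‖ ^ 2 := Finset.sum_comm
      _ ≤ _ := Finset.sum_le_sum fun x _ => key x
  exact_mod_cast this


lemma exists_ueb (D : Type) [Fintype D] [DecidableEq D] [Nonempty D] :
    ∃ U : D × D → D → D → ℂ,
      (∀ g t t', ∑ l, star (U g l t) * U g l t' = if t = t' then 1 else 0) ∧
      (∀ g g', g ≠ g' → ∑ t, ∑ l, U g l t * star (U g' l t) = 0) := by
  let N := Fintype.card D
  haveI : NeZero N := ⟨Fintype.card_ne_zero⟩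
  have e : D ≃ ZMod N := Fintype.equivOfCardEq (by simp [N, ZMod.card])
  let χ : AddChar (ZMod N) ℂ := ZMod.stdAddChar
  have hχ : χ.IsPrimitive := ZMod.isPrimitive_stdAddChar N
  refine ⟨fun g l t => if e l = e t + e g.1 then χ (e t * e g.2) else 0, ?_, ?_⟩
  · intro g t t'
    rw [Finset.sum_eq_single (e.symm (e t + e g.1))]
    · simp only [Equiv.apply_symm_apply, if_true, add_left_inj, EmbeddingLike.apply_eq_iff_eq]
      split_ifs with h
      · subst h
        rw [RCLike.star_def, ← AddChar.map_neg_eq_conj, ← AddChar.map_add_eq_mul]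
        simp
      · simp
    · intro l _ hl
      beta_reduce
      rw [if_neg (c := e l = e t + e g.1)]
      · simp
      · intro h
        apply hl
        rw [← h]; simp
    · simp
  · intro g g' hg
    by_cases h1 : g.1 = g'.1
    · have h2 : g.2 ≠ g'.2 := fun h2 => hg (Prod.ext h1 h2)
      have h3 : ∀ t, ∑ l, (if e l = e t + e g.1 then χ (e t * e g.2) else 0) *
          star (if e l = e t + e g'.1 then χ (e t * e g'.2) else 0) =
          χ (e t * (e g.2 - e g'.2)) := by
        intro t
        rw [Finset.sum_eq_single (e.symm (e t + e g.1))]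
        · rw [h1]
          simp only [Equiv.apply_symm_apply, if_true]
          rw [RCLike.star_def, ← AddChar.map_neg_eq_conj, ← AddChar.map_add_eq_mul]
          congr 1
          ring
        · intro l _ hl
          rw [if_neg]
          · simp
          · intro h
            apply hl
            rw [← h]; simp
        · simp
      simp only [h3]
      rw [e.sum_comp (fun t => χ (t * (e g.2 - e g'.2))), AddChar.sum_mulShift _ hχ, if_neg]
      · simp
      · rw [sub_eq_zero]; exact fun h => h2 (e.injective h)
    · apply Finset.sum_eq_zero
      intro t _
      apply Finset.sum_eq_zero
      intro l _
      beta_reduce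
      by_cases h : e l = e t + e g.1
      · rw [if_neg (c := e l = e t + e g'.1)]
        · simp
        · intro h'
          rw [h] at h'
          exact h1 (e.injective (add_left_cancel h'))
      · rw [if_neg h]; simp

lemma sum_ite_inj {p L : Type} [Fintype p] [DecidableEq p] [Fintype L] [DecidableEq L] (F : L → p)
    (hF : Function.Injective F) (u w : L → ℂ) :
    ∑ i, star (∑ l, if i = F l then u l else 0) * (∑ l, if i = F l then w l else 0)
      = ∑ l, star (u l) * w l := by
  have h1 : ∀ (w : L → ℂ) l, (∑ l', if F l = F l' then w l' else 0) = w l := by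
    intro w l
    simp [hF.eq_iff]
  have h2 : ∀ i, star (∑ l, if i = F l then u l else 0) * (∑ l, if i = F l then w l else 0) =
      ∑ l, if i = F l then star (u l) * w l else 0 := by
    intro i
    by_cases hi : ∃ l, i = F l
    · obtain ⟨l, rfl⟩ := hi
      rw [h1, h1, h1 (fun l => star (u l) * w l)]
    · push Not at hi
      simp [hi]
  simp only [h2]
  rw [Finset.sum_comm]
  simp

lemma BlockData.ea_ge (B : BlockData D E S) (a0 : ∀ x, E x) [∀ x, Nonempty (D x)] (M : ℕ)
    (hM : M = ∑ x, Fintype.card (D x) ^ 2) : IsEAIndepFamily S M := by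
  have eM : Fin M ≃ (x : X) × (D x × D x) := Fintype.equivOfCardEq (by simp [hM, sq])
  let n := ∏ x, Fintype.card (D x)
  have hn : 1 ≤ n := Finset.prod_pos fun x _ => Fintype.card_pos
  have hq : ∀ x, ∃ q, n = Fintype.card (D x) * q := fun x =>
    Finset.dvd_prod_of_mem (fun x => Fintype.card (D x)) (Finset.mem_univ x)
  choose q hq using hq
  have hqn : ∀ x, q x ≤ n := by
    intro x
    rw [hq x]
    exact Nat.le_mul_of_pos_left _ Fintype.card_pos
  have e : ∀ x, Fin n ≃ D x × Fin (q x) := fun x =>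
    Fintype.equivOfCardEq (by simp [← hq])
  choose U hU1 hU2 using fun x => exists_ueb (D x)
  let F : ∀ x, D x → ι := fun x l => B.f ⟨x, l, a0 x⟩
  have hF : ∀ x, Function.Injective (F x) := by
    intro x l l' h
    have := B.f.injective h
    simpa using this
  let V : Fin M → Matrix (ι × Fin n) (Fin n) ℂ := fun i => Matrix.of fun ps f =>
    ∑ l, if ps.1 = F (eM i).1 l then
      (if ps.2 = Fin.castLE (hqn _) (e (eM i).1 f).2 then U (eM i).1 (eM i).2 l (e (eM i).1 f).1 else 0)
      else 0
  have hV : ∀ x l a s i f, V i (B.f ⟨x, l, a⟩, s) f ≠ 0 → x = (eM i).1 ∧ HEq a (a0 x) := by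
    intro x l a s i f h
    obtain ⟨l', -, hl⟩ := Finset.exists_ne_zero_of_sum_ne_zero h
    have h1 : B.f ⟨x, l, a⟩ = F (eM i).1 l' := by
      by_contra h1
      simp [h1] at hl
    have h1 := B.f.injective h1
    have aux : ∀ (y : X) (l' : D y), (⟨x, l, a⟩ : (x : X) × (D x × E x)) = ⟨y, l', a0 y⟩ →
        x = y ∧ HEq a (a0 x) := by
      intro y l' h
      obtain rfl : x = y := congrArg (fun p : (x : X) × (D x × E x) => p.1) h
      simp at h
      simp [h.2]
    exact aux _ _ h1
  have hV' : ∀ x g i, eM i = ⟨x, g⟩ → ∀ l s f, V i (B.f ⟨x, l, a0 x⟩, s) f =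
      if s = Fin.castLE (hqn _) (e x f).2 then U x g l (e x f).1 else 0 := by
    intro x g i hi l s f
    simp only [V, Matrix.of_apply]
    rw [hi]
    rw [Finset.sum_eq_single l]
    · simp [F]
    · intro l' _ hl
      rw [if_neg]
      intro h
      exact hl (hF x h).symm
    · simp
  refine ⟨n, n, hn, hn, (n : ℂ)⁻¹ • 1, ⟨?_, ?_⟩, V, ?_, ?_⟩
  · apply Matrix.PosSemidef.smul Matrix.PosSemidef.one
    positivity
  · have : (n : ℂ) ≠ 0 := by
      have : n ≠ 0 := by omega
      exact_mod_cast this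
    simp [Matrix.trace_smul, this]
  · intro i
    ext f f'
    simp only [Matrix.mul_apply, Matrix.conjTranspose_apply, V, Matrix.of_apply]
    generalize eM i = g
    obtain ⟨x, g⟩ := g
    rw [Fintype.sum_prod_type, Finset.sum_comm]
    simp only [sum_ite_inj (F x) (hF x)]
    rw [Finset.sum_comm]
    have h1 : ∀ l, ∑ s, star (if s = Fin.castLE (hqn x) (e x f).2 then U x g l (e x f).1 else 0) *
        (if s = Fin.castLE (hqn x) (e x f').2 then U x g l (e x f').1 else 0) =
        if (e x f).2 = (e x f').2 then star (U x g l (e x f).1) * U x g l (e x f').1 else 0 := by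
      intro l
      rw [Finset.sum_eq_single (Fin.castLE (hqn x) (e x f).2)]
      · simp only [if_true, (Fin.castLE_injective (hqn x)).eq_iff]
        split_ifs <;> simp
      · intro s _ hs; simp [hs]
      · simp
    simp only [h1]
    rw [Matrix.one_apply]
    by_cases h2 : (e x f).2 = (e x f').2
    · simp only [h2, if_true]
      rw [hU1]
      by_cases h3 : f = f'
      · simp [h3]
      · rw [if_neg h3, if_neg]
        intro h4
        exact h3 ((e x).injective (Prod.ext h4 h2))
    · simp only [h2, if_false]
      rw [if_neg]
      · simp
      · rintro rfl; exact h2 rfl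
  · intro i i' hii
    refine (B.orthW _).2 ?_
    intro x a b s t
    have h0 : ∀ l, (V i * ((n : ℂ)⁻¹ • (1 : Matrix (Fin n) (Fin n) ℂ)) * (V i')ᴴ)
        (B.f ⟨x, l, a⟩, s) (B.f ⟨x, l, b⟩, t) =
        (n : ℂ)⁻¹ * ∑ f, V i (B.f ⟨x, l, a⟩, s) f * star (V i' (B.f ⟨x, l, b⟩, t) f) := by
      intro l
      simp [Matrix.mul_apply, Finset.mul_sum, mul_assoc]
    simp only [h0]
    rw [← Finset.mul_sum]
    apply mul_eq_zero_of_right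
    by_cases hz : ∃ l f, V i (B.f ⟨x, l, a⟩, s) f * star (V i' (B.f ⟨x, l, b⟩, t) f) ≠ 0
    swap
    · push Not at hz
      exact Finset.sum_eq_zero fun l _ => Finset.sum_eq_zero fun f _ => hz l f
    obtain ⟨l, f, hz⟩ := hz
    obtain ⟨h1, h2⟩ := hV _ _ _ _ _ _ (left_ne_zero_of_mul hz)
    have hz' := right_ne_zero_of_mul hz
    rw [star_ne_zero] at hz'
    obtain ⟨h3, h4⟩ := hV _ _ _ _ _ _ hz'
    have ha := eq_of_heq h2
    have hb := eq_of_heq h4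
    clear hz hz' h2 h4
    subst ha hb
    obtain ⟨g, hg⟩ : ∃ g, eM i = ⟨x, g⟩ := by
      rw [h1]; exact ⟨_, rfl⟩
    obtain ⟨g', hg'⟩ : ∃ g, eM i' = ⟨x, g⟩ := by
      rw [h3]; exact ⟨_, rfl⟩
    have hgg : g ≠ g' := by
      rintro rfl
      exact hii (eM.injective (hg.trans hg'.symm))
    simp only [hV' x g i hg, hV' x g' i' hg']
    rw [Finset.sum_comm, ← (e x).symm.sum_comp, Fintype.sum_prod_type, Finset.sum_comm]
    apply Finset.sum_eq_zero
    intro k _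
    simp only [Equiv.apply_symm_apply]
    by_cases hs : s = Fin.castLE (hqn x) k
    · by_cases ht : t = Fin.castLE (hqn x) k
      · simp only [if_pos hs, if_pos ht]
        exact hU2 x g g' hgg
      · simp [ht]
    · simp [hs]

end core

lemma blockAlgebra_entries {K : ℕ} (d m : Fin K → ℕ) (Y : Matrix (BlockIdx d m) (BlockIdx d m) ℂ)
    (hY : Y ∈ blockAlgebra d m) :
    (∀ k k' i i' a b, (⟨k, i⟩ : (k : Fin K) × Fin (d k)) ≠ ⟨k', i'⟩ →
      Y ⟨k, i, a⟩ ⟨k', i', b⟩ = 0) ∧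
    (∀ k i i' a b, Y ⟨k, i, a⟩ ⟨k, i, b⟩ = Y ⟨k, i', a⟩ ⟨k, i', b⟩) := by
  induction hY using Submodule.span_induction with
  | mem Y hY =>
    obtain ⟨k0, B, rfl⟩ := hY
    constructor
    · intro k k' i i' a b h
      unfold blockMatrix
      by_cases hk : k = k0
      · by_cases hk' : k' = k0
        · subst hk
          subst hk'
          have : i ≠ i' := by rintro rfl; exact h rfl
          simp [this]
        · simp [hk']
      · simp [hk]
    · intro k i i' a b
      unfold blockMatrix
      by_cases hk : k = k0
      · subst hk
        simp
      · simp [hk]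
  | zero => simp
  | add A B _ _ hA hB =>
    refine ⟨fun k k' i i' a b h => ?_, fun k i i' a b => ?_⟩
    · simp [hA.1 k k' i i' a b h, hB.1 k k' i i' a b h]
    · simp [hA.2 k i i' a b, hB.2 k i i' a b]
  | smul c A _ hA =>
    refine ⟨fun k k' i i' a b h => ?_, fun k i i' a b => ?_⟩
    · simp [hA.1 k k' i i' a b h]
    · simp [hA.2 k i i' a b]

/-- The block structure on the tensor index. -/
def tensorEquiv {K K' : ℕ} (d m : Fin K → ℕ) (d' m' : Fin K' → ℕ) :
    ((x : Fin K × Fin K') × ((Fin (d x.1) × Fin (d' x.2)) × (Fin (m x.1) × Fin (m' x.2)))) ≃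
      BlockIdx d m × BlockIdx d' m' where
  toFun p := (⟨p.1.1, p.2.1.1, p.2.2.1⟩, ⟨p.1.2, p.2.1.2, p.2.2.2⟩)
  invFun p := ⟨(p.1.1, p.2.1), (p.1.2.1, p.2.2.1), (p.1.2.2, p.2.2.2)⟩
  left_inv _ := rfl
  right_inv _ := rfl

lemma tensor_entries {K K' : ℕ} (d m : Fin K → ℕ) (d' m' : Fin K' → ℕ)
    (Y : Matrix (BlockIdx d m × BlockIdx d' m') (BlockIdx d m × BlockIdx d' m') ℂ)
    (hY : Y ∈ tensorSpan (blockAlgebra d m) (blockAlgebra d' m')) :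
    (∀ k1 k1' i1 i1' a1 b1 k2 k2' i2 i2' a2 b2,
      ((⟨k1, i1⟩ : (k : Fin K) × Fin (d k)) ≠ ⟨k1', i1'⟩ ∨
        (⟨k2, i2⟩ : (k : Fin K') × Fin (d' k)) ≠ ⟨k2', i2'⟩) →
      Y (⟨k1, i1, a1⟩, ⟨k2, i2, a2⟩) (⟨k1', i1', b1⟩, ⟨k2', i2', b2⟩) = 0) ∧
    (∀ k1 i1 i1' a1 b1 k2 i2 i2' a2 b2,
      Y (⟨k1, i1, a1⟩, ⟨k2, i2, a2⟩) (⟨k1, i1, b1⟩, ⟨k2, i2, b2⟩) =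
      Y (⟨k1, i1', a1⟩, ⟨k2, i2', a2⟩) (⟨k1, i1', b1⟩, ⟨k2, i2', b2⟩)) := by
  induction hY using Submodule.span_induction with
  | mem Y hY =>
    obtain ⟨A, hA, B, hB, rfl⟩ := hY
    have hA := blockAlgebra_entries d m A hA
    have hB := blockAlgebra_entries d' m' B hB
    refine ⟨?_, ?_⟩
    · intro k1 k1' i1 i1' a1 b1 k2 k2' i2 i2' a2 b2 h
      rw [Matrix.kroneckerMap_apply]
      rcases h with h | h
      · rw [hA.1 _ _ _ _ _ _ h, zero_mul]
      · rw [hB.1 _ _ _ _ _ _ h, mul_zero]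
    · intro k1 i1 i1' a1 b1 k2 i2 i2' a2 b2
      rw [Matrix.kroneckerMap_apply, Matrix.kroneckerMap_apply]
      simp only
      rw [hA.2 k1 i1 i1', hB.2 k2 i2 i2']
  | zero => simp
  | add A B _ _ hA hB =>
    refine ⟨?_, ?_⟩
    · intro k1 k1' i1 i1' a1 b1 k2 k2' i2 i2' a2 b2 h
      rw [Matrix.add_apply, hA.1 _ _ _ _ _ _ _ _ _ _ _ _ h, hB.1 _ _ _ _ _ _ _ _ _ _ _ _ h, add_zero]
    · intro k1 i1 i1' a1 b1 k2 i2 i2' a2 b2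
      rw [Matrix.add_apply, Matrix.add_apply, hA.2 k1 i1 i1' a1 b1 k2 i2 i2' a2 b2,
        hB.2 k1 i1 i1' a1 b1 k2 i2 i2' a2 b2]
  | smul c A _ hA =>
    refine ⟨?_, ?_⟩
    · intro k1 k1' i1 i1' a1 b1 k2 k2' i2 i2' a2 b2 h
      rw [Matrix.smul_apply, hA.1 _ _ _ _ _ _ _ _ _ _ _ _ h, smul_zero]
    · intro k1 i1 i1' a1 b1 k2 i2 i2' a2 b2
      rw [Matrix.smul_apply, Matrix.smul_apply, hA.2 k1 i1 i1' a1 b1 k2 i2 i2' a2 b2]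

lemma blockMatrix_single {K : ℕ} (d m : Fin K → ℕ) (k : Fin K) (a b : Fin (m k)) :
    blockMatrix d m k (Matrix.single a b 1) =
      ∑ l : Fin (d k), Matrix.single (⟨k, l, a⟩ : BlockIdx d m) ⟨k, l, b⟩ (1 : ℂ) := by
  ext ⟨k1, i1, a1⟩ ⟨k2, i2, a2⟩
  unfold blockMatrix
  rw [Matrix.sum_apply]
  by_cases hk : k1 = k
  · by_cases hk' : k2 = k
    · subst hk
      subst hk'
      simp only [dif_pos, Fin.cast_eq_self, Matrix.single_apply]
      rw [Finset.sum_eq_single i1]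
      · by_cases h : i1 = i2 <;> simp [h]
      · intro l _ hl
        rw [if_neg]
        simp [hl]
      · simp
    · rw [Finset.sum_eq_zero]
      · simp [hk']
      · intro l _
        rw [Matrix.single_apply, if_neg]
        rintro ⟨-, h⟩
        exact hk' (congrArg Sigma.fst h).symm
  · rw [Finset.sum_eq_zero]
    · simp [hk]
    · intro l _
      rw [Matrix.single_apply, if_neg]
      rintro ⟨h, -⟩
      exact hk (congrArg Sigma.fst h).symm

/-- The tensor product of two block algebras is a block algebra. -/
def tensorBlockData {K K' : ℕ} (d m : Fin K → ℕ) (d' m' : Fin K' → ℕ) :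
    BlockData (X := Fin K × Fin K') (fun x => Fin (d x.1) × Fin (d' x.2))
      (fun x => Fin (m x.1) × Fin (m' x.2))
      (tensorSpan (blockAlgebra d m) (blockAlgebra d' m')) where
  f := tensorEquiv d m d' m'
  unit_mem := by
    rintro ⟨k, j⟩ ⟨a, a'⟩ ⟨b, b'⟩
    apply Submodule.subset_span
    refine ⟨blockMatrix d m k (Matrix.single a b 1), Submodule.subset_span ⟨k, _, rfl⟩,
      blockMatrix d' m' j (Matrix.single a' b' 1), Submodule.subset_span ⟨j, _, rfl⟩, ?_⟩
    rw [blockMatrix_single, blockMatrix_single]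
    ext p q
    rw [Matrix.kroneckerMap_apply, Matrix.sum_apply, Matrix.sum_apply, Matrix.sum_apply,
      Finset.sum_mul_sum, Fintype.sum_prod_type]
    refine Finset.sum_congr rfl fun l _ => Finset.sum_congr rfl fun l' _ => ?_
    have := Matrix.single_kronecker_single (⟨k, l, a⟩ : BlockIdx d m) (⟨k, l, b⟩ : BlockIdx d m)
      (⟨j, l', a'⟩ : BlockIdx d' m') (⟨j, l', b'⟩ : BlockIdx d' m') (1 : ℂ) (1 : ℂ)
    have := congrFun (congrFun this p) q
    rw [Matrix.kroneckerMap_apply, mul_one] at this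
    exact this.symm
  off := by
    rintro Y hY ⟨k, j⟩ ⟨k', j'⟩ h ⟨l1, l2⟩ ⟨l1', l2'⟩ ⟨a1, a2⟩ ⟨b1, b2⟩
    refine (tensor_entries d m d' m' Y hY).1 _ _ _ _ _ _ _ _ _ _ _ _ ?_
    by_contra! hc
    exact h (Prod.ext (congrArg Sigma.fst hc.1) (congrArg Sigma.fst hc.2))
  offd := by
    rintro Y hY ⟨k, j⟩ ⟨l1, l2⟩ ⟨l1', l2'⟩ h ⟨a1, a2⟩ ⟨b1, b2⟩
    refine (tensor_entries d m d' m' Y hY).1 _ _ _ _ _ _ _ _ _ _ _ _ ?_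
    by_contra! hc
    apply h
    simpa using hc
  const := by
    rintro Y hY ⟨k, j⟩ ⟨l1, l2⟩ ⟨l1', l2'⟩ ⟨a1, a2⟩ ⟨b1, b2⟩
    exact (tensor_entries d m d' m' Y hY).2 _ _ _ _ _ _ _ _ _ _

/-- Multiplicativity of the independence numbers of block *-algebras: for
`S = ⊕ₖ (1_{d k} ⊗ M_{m k}(ℂ))` and `T = ⊕ⱼ (1_{d' j} ⊗ M_{m' j}(ℂ))`, the independence,
private, quantum and entanglement-assisted independence numbers of `S ⊗ T` are
`α(S)α(T) = (∑ₖ d k)(∑ⱼ d' j)`, `α_p(S)α_p(T) = (maxₖ d k)(maxⱼ d' j)`,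
`α_q(S)α_q(T) = (maxₖ d k)(maxⱼ d' j)` and `α_ea(S)α_ea(T) = (∑ₖ (d k)²)(∑ⱼ (d' j)²)`. -/
theorem indepNumbers_tensor_blockAlgebras
    (K K' : ℕ) (hK : 1 ≤ K) (hK' : 1 ≤ K')
    (d m : Fin K → ℕ) (hd : ∀ k, 1 ≤ d k) (hm : ∀ k, 1 ≤ m k)
    (d' m' : Fin K' → ℕ) (hd' : ∀ j, 1 ≤ d' j) (hm' : ∀ j, 1 ≤ m' j) :
    ((∃ ρ : Fin ((∑ k, d k) * (∑ j, d' j)) →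
        Matrix (BlockIdx d m × BlockIdx d' m') (BlockIdx d m × BlockIdx d' m') ℂ,
        IsIndepFamily (tensorSpan (blockAlgebra d m) (blockAlgebra d' m')) ρ) ∧
      (∀ (M : ℕ) (ρ : Fin M →
          Matrix (BlockIdx d m × BlockIdx d' m') (BlockIdx d m × BlockIdx d' m') ℂ),
        IsIndepFamily (tensorSpan (blockAlgebra d m) (blockAlgebra d' m')) ρ →
          M ≤ (∑ k, d k) * (∑ j, d' j))) ∧
    ((∃ ρ : Fin (Finset.univ.sup d * Finset.univ.sup d') →
        Matrix (BlockIdx d m × BlockIdx d' m') (BlockIdx d m × BlockIdx d' m') ℂ,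
        IsPrivateIndepFamily (tensorSpan (blockAlgebra d m) (blockAlgebra d' m')) ρ) ∧
      (∀ (M : ℕ) (ρ : Fin M →
          Matrix (BlockIdx d m × BlockIdx d' m') (BlockIdx d m × BlockIdx d' m') ℂ),
        IsPrivateIndepFamily (tensorSpan (blockAlgebra d m) (blockAlgebra d' m')) ρ →
          M ≤ Finset.univ.sup d * Finset.univ.sup d')) ∧
    ((∃ P : Matrix (BlockIdx d m × BlockIdx d' m') (BlockIdx d m × BlockIdx d' m') ℂ,
        IsKLProjection (tensorSpan (blockAlgebra d m) (blockAlgebra d' m')) P ∧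
          P.trace = ((Finset.univ.sup d * Finset.univ.sup d' : ℕ) : ℂ)) ∧
      (∀ P : Matrix (BlockIdx d m × BlockIdx d' m') (BlockIdx d m × BlockIdx d' m') ℂ,
        IsKLProjection (tensorSpan (blockAlgebra d m) (blockAlgebra d' m')) P →
          (P.trace).re ≤ ((Finset.univ.sup d * Finset.univ.sup d' : ℕ) : ℝ))) ∧
    (IsEAIndepFamily (tensorSpan (blockAlgebra d m) (blockAlgebra d' m'))
        ((∑ k, (d k) ^ 2) * (∑ j, (d' j) ^ 2)) ∧
      (∀ M : ℕ,
        IsEAIndepFamily (tensorSpan (blockAlgebra d m) (blockAlgebra d' m')) M →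
          M ≤ (∑ k, (d k) ^ 2) * (∑ j, (d' j) ^ 2))) := by
  let B := tensorBlockData d m d' m'
  have a0 : ∀ x : Fin K × Fin K', Fin (m x.1) × Fin (m' x.2) := fun x =>
    (⟨0, hm x.1⟩, ⟨0, hm' x.2⟩)
  haveI : ∀ x : Fin K × Fin K', Nonempty (Fin (d x.1) × Fin (d' x.2)) := fun x =>
    ⟨(⟨0, hd x.1⟩, ⟨0, hd' x.2⟩)⟩
  obtain ⟨k, -, hk⟩ := Finset.exists_mem_eq_sup (Finset.univ : Finset (Fin K)) ⟨⟨0, hK⟩, by simp⟩ d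
  obtain ⟨j, -, hj⟩ := Finset.exists_mem_eq_sup (Finset.univ : Finset (Fin K')) ⟨⟨0, hK'⟩, by simp⟩ d'
  have hle : ∀ x : Fin K × Fin K', Fintype.card (Fin (d x.1) × Fin (d' x.2)) ≤
      Finset.univ.sup d * Finset.univ.sup d' := by
    intro x
    simp only [Fintype.card_prod, Fintype.card_fin]
    exact Nat.mul_le_mul (Finset.le_sup (Finset.mem_univ _)) (Finset.le_sup (Finset.mem_univ _))
  have heq : Finset.univ.sup d * Finset.univ.sup d' =
      Fintype.card (Fin (d (k, j).1) × Fin (d' (k, j).2)) := by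
    simp only [Fintype.card_prod, Fintype.card_fin]
    rw [hk, hj]
  have h1 : (∑ k, d k) * (∑ j, d' j) =
      ∑ x : Fin K × Fin K', Fintype.card (Fin (d x.1) × Fin (d' x.2)) := by
    simp only [Fintype.card_prod, Fintype.card_fin]
    rw [Finset.sum_mul_sum, Fintype.sum_prod_type]
  have h2 : (∑ k, (d k) ^ 2) * (∑ j, (d' j) ^ 2) =
      ∑ x : Fin K × Fin K', Fintype.card (Fin (d x.1) × Fin (d' x.2)) ^ 2 := by
    simp only [Fintype.card_prod, Fintype.card_fin, mul_pow]
    rw [Finset.sum_mul_sum, Fintype.sum_prod_type]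
  refine ⟨⟨B.alpha_ge a0 _ h1, fun M ρ h => h1 ▸ B.alpha_le h⟩,
    ⟨B.alphap_ge a0 _ (k, j) heq, fun M ρ h => B.alphap_le h _ hle⟩,
    ⟨B.alphaq_ge a0 _ (k, j) heq, fun P h => B.alphaq_le h _ hle⟩,
    ⟨B.ea_ge a0 _ h2, fun M h => h2 ▸ B.ea_le h⟩⟩
end

section
/- Let a, b ≥ 1 and let ρ : Matrix (Fin a × Fin b) (Fin a × Fin b) ℂ be a state (positive semidefinite with trace 1). Then there exist N ≥ 1, nonnegative reals p : Fin N → ℝ with ∑ i, p i = 1, and states σA : Fin N → Matrix (Fin a) (Fin a) ℂ and σB : Fin N → Matrix (Fin b) (Fin b) ℂ, such that the matrix ((min a b : ℝ)) • (∑ i, p i • (σA i ⊗ₖ σB i)) − ρ is positive semidefinite. (This is the paper's Lemma that the max-relative entropy of entanglement of any bipartite state is at most log min(d_A, d_B): there is a separable state σ with ρ ≤ min(d_A,d_B) · σ.) -/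
open Matrix Kronecker ComplexOrder

theorem pinch_aux {α β : Type*} [Fintype α] [DecidableEq α] [Fintype β] [DecidableEq β]
    (ρ : Matrix (α × β) (α × β) ℂ) (hρ : ρ.PosSemidef) :
    (Matrix.of (fun x y : α × β =>
      (Fintype.card α : ℂ) * (if x.1 = y.1 then ρ x y else 0)) - ρ).PosSemidef := by
  have key : Matrix.of (fun x y : α × β =>
      (Fintype.card α : ℂ) * (if x.1 = y.1 then ρ x y else 0)) - ρ =
      (2⁻¹ : ℝ) • ∑ i : α, ∑ j : α,
        (diagonal (fun x : α × β => (if x.1 = i then (1:ℂ) else 0) - if x.1 = j then 1 else 0))ᴴ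
        * ρ * (diagonal (fun x : α × β => (if x.1 = i then (1:ℂ) else 0) - if x.1 = j then 1 else 0)) := by
    ext x y
    have h : ∀ i j : α, (((diagonal (fun x : α × β => (if x.1 = i then (1:ℂ) else 0) - if x.1 = j then 1 else 0))ᴴ
        * ρ * (diagonal (fun x : α × β => (if x.1 = i then (1:ℂ) else 0) - if x.1 = j then 1 else 0))) x y)
        = ρ x y * ((if x.1 = i then (if y.1 = i then 1 else 0) else 0)
          - (if x.1 = i then 1 else 0) * (if y.1 = j then 1 else 0)
          - (if x.1 = j then 1 else 0) * (if y.1 = i then 1 else 0)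
          + (if x.1 = j then (if y.1 = j then 1 else 0) else 0)) := by
      intro i j
      rw [diagonal_conjTranspose, mul_diagonal, diagonal_mul]
      simp only [Pi.star_apply, star_sub]
      split_ifs <;> simp
    simp only [Matrix.sub_apply, Matrix.smul_apply, Matrix.sum_apply, h, of_apply]
    simp only [← Finset.mul_sum, Finset.sum_add_distrib, Finset.sum_sub_distrib]
    simp only [← Finset.sum_mul]
    simp
    by_cases hxy : x.1 = y.1
    · simp [hxy]; ring
    · simp [hxy, Ne.symm hxy]; ring
  rw [key]
  refine PosSemidef.smul ?_ (by positivity)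
  refine posSemidef_sum _ fun i _ => posSemidef_sum _ fun j _ => ?_
  exact hρ.conjTranspose_mul_mul_same _

theorem sep_aux (a b : ℕ) (ha : 0 < a) (hb : 0 < b)
    (ρ : Matrix (Fin a × Fin b) (Fin a × Fin b) ℂ)
    (hρ : ρ.PosSemidef) (hρtr : ρ.trace = 1) :
      ∃ p : Fin a → ℝ, (∀ i, 0 ≤ p i) ∧ (∑ i, p i) = 1 ∧
        ∃ (σA : Fin a → Matrix (Fin a) (Fin a) ℂ)
          (σB : Fin a → Matrix (Fin b) (Fin b) ℂ),
          (∀ i, (σA i).PosSemidef ∧ (σA i).trace = 1) ∧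
          (∀ i, (σB i).PosSemidef ∧ (σB i).trace = 1) ∧
          ((a : ℝ) • (∑ i, p i • (σA i ⊗ₖ σB i)) - ρ).PosSemidef := by
  let R : Fin a → Matrix (Fin b) (Fin b) ℂ := fun i => ρ.submatrix (Prod.mk i) (Prod.mk i)
  have hR : ∀ i, (R i).PosSemidef := fun i => hρ.submatrix _
  have hunit : ∀ (n : ℕ) (i : Fin n), (Matrix.single i i (1:ℂ)).PosSemidef ∧
      (Matrix.single i i (1:ℂ)).trace = 1 := by
    intro n i
    refine ⟨?_, by simp⟩
    rw [← Matrix.diagonal_single]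
    refine PosSemidef.diagonal (fun j => ?_)
    by_cases h : j = i
    · subst h; simp
    · simp [h]
  have htr : ∀ i, (((R i).trace.re : ℝ) : ℂ) = (R i).trace := fun i =>
    (Complex.eq_re_of_ofReal_le (r := 0) (by simpa using (hR i).trace_nonneg)).symm
  have hex : ∀ i, ∃ S : Matrix (Fin b) (Fin b) ℂ, (S.PosSemidef ∧ S.trace = 1) ∧
      (R i).trace.re • S = R i := by
    intro i
    have h0 : 0 ≤ (R i).trace.re := (Complex.le_def.1 (hR i).trace_nonneg).1
    by_cases h : (R i).trace.re = 0
    · refine ⟨_, hunit b ⟨0, hb⟩, ?_⟩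
      have : (R i).trace = 0 := by rw [← htr, h]; simp
      rw [h, zero_smul, ((hR i).trace_eq_zero_iff.1 this)]
    · refine ⟨(R i).trace.re⁻¹ • R i, ⟨(hR i).smul (by positivity), ?_⟩, ?_⟩
      · rw [trace_smul, ← htr i]
        simp only [Complex.ofReal_re, Complex.real_smul]
        rw [← Complex.ofReal_mul, inv_mul_cancel₀ h, Complex.ofReal_one]
      · rw [smul_smul, mul_inv_cancel₀ h, one_smul]
  choose S hS hS2 using hex
  refine ⟨fun i => (R i).trace.re, fun i => (Complex.le_def.1 (hR i).trace_nonneg).1, ?_,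
    fun i => Matrix.single i i 1, S, hunit a, hS, ?_⟩
  · rw [← Complex.ofReal_inj, Complex.ofReal_sum]
    simp only [htr]
    rw [Complex.ofReal_one, ← hρtr]
    simp [R, Matrix.trace, Fintype.sum_prod_type]
  · convert pinch_aux ρ hρ using 2
    simp only [← kronecker_smul, hS2]
    ext x y
    obtain ⟨i, k⟩ := x
    obtain ⟨j, l⟩ := y
    simp only [Matrix.smul_apply, Matrix.sum_apply, kroneckerMap_apply, of_apply, single_apply, R,
      submatrix_apply]
    by_cases h : i = j
    · subst h; simp
    · have : ∀ x, ¬ (x = i ∧ x = j) := by rintro x ⟨rfl, h'⟩; exact h h'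
      simp [h, this]


/-- The max-relative entropy of entanglement of any bipartite state is at most
`log min(d_A, d_B)`: there is a separable state `σ` with `ρ ≤ min(d_A, d_B) • σ` in the
Loewner order. -/
theorem exists_separable_dominating
    (a b : ℕ) (ha : 0 < a) (hb : 0 < b)
    (ρ : Matrix (Fin a × Fin b) (Fin a × Fin b) ℂ)
    (hρ : ρ.PosSemidef) (hρtr : ρ.trace = 1) :
    ∃ N : ℕ, 1 ≤ N ∧
      ∃ p : Fin N → ℝ, (∀ i, 0 ≤ p i) ∧ (∑ i, p i) = 1 ∧
        ∃ (σA : Fin N → Matrix (Fin a) (Fin a) ℂ)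
          (σB : Fin N → Matrix (Fin b) (Fin b) ℂ),
          (∀ i, (σA i).PosSemidef ∧ (σA i).trace = 1) ∧
          (∀ i, (σB i).PosSemidef ∧ (σB i).trace = 1) ∧
          (((min a b : ℕ) : ℝ) • (∑ i, p i • (σA i ⊗ₖ σB i)) - ρ).PosSemidef := by
  rcases le_total a b with h | h
  · obtain ⟨p, h1, h2, σA, σB, h3, h4, h5⟩ := sep_aux a b ha hb ρ hρ hρtr
    refine ⟨a, ha, p, h1, h2, σA, σB, h3, h4, ?_⟩
    rwa [min_eq_left h]
  · obtain ⟨p, h1, h2, σB, σA, h3, h4, h5⟩ := sep_aux b a hb ha (ρ.submatrix Prod.swap Prod.swap)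
      (hρ.submatrix _) (by
        rw [← hρtr]
        exact (Equiv.prodComm (Fin b) (Fin a)).sum_comp (fun x => ρ x x))
    refine ⟨b, hb, p, h1, h2, σA, σB, h4, h3, ?_⟩
    rw [min_eq_right h]
    convert h5.submatrix Prod.swap using 1
    ext x y
    simp [Matrix.sum_apply, mul_comm]
end

section
/- Let δ, μ : ℝ with 0 < δ < 1 and 0 < μ < 1, let α : ℝ with 1 < α, let d : ℕ with 1 ≤ d, and let t : ℝ. Set u := (Real.log ((d : ℝ) ^ ((d : ℝ) + α) / δ)) / d − Real.log (μ * Real.log (1/μ) / (1 − μ^2)) − 1, and assume 0 ≤ u and t ≥ ((d : ℝ) / Real.log (1/μ)) * (u + 1 + Real.sqrt (2 * u)). Then (d : ℝ) ^ α * ((t * (1 − μ^2)) / μ) ^ d * μ ^ t ≤ δ, where (d:ℝ)^α and μ^t are real powers (rpow) and (·)^d is the d-th power. (The paper's Lambert-W lemma giving an explicit time after which the exponentially decaying bound d^α (t(1−μ²)/μ)^d μ^t drops below δ.) -/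
/-- The Lambert-W lemma: an explicit time `t` after which the exponentially decaying bound
`d^α (t(1−μ²)/μ)^d μ^t` drops below `δ`. -/
theorem rpow_bound_of_lambert
    (δ μ α : ℝ) (hδ0 : 0 < δ) (hδ1 : δ < 1) (hμ0 : 0 < μ) (hμ1 : μ < 1) (hα : 1 < α)
    (d : ℕ) (hd : 1 ≤ d) (t : ℝ) (u : ℝ)
    (hu : u = Real.log ((d : ℝ) ^ ((d : ℝ) + α) / δ) / (d : ℝ)
      - Real.log (μ * Real.log (1 / μ) / (1 - μ ^ 2)) - 1)
    (hu0 : 0 ≤ u)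
    (ht : ((d : ℝ) / Real.log (1 / μ)) * (u + 1 + Real.sqrt (2 * u)) ≤ t) :
    (d : ℝ) ^ α * ((t * (1 - μ ^ 2)) / μ) ^ d * μ ^ t ≤ δ := by
  have hD : (0:ℝ) < d := by exact_mod_cast hd
  have hlogμ : Real.log μ = - Real.log (1 / μ) := by
    rw [one_div, Real.log_inv]; ring
  have hL : 0 < Real.log (1 / μ) := by
    have := Real.log_neg hμ0 hμ1
    linarith
  have hq : 0 < 1 - μ ^ 2 := by nlinarith
  generalize Real.log (1 / μ) = L at *
  generalize 1 - μ ^ 2 = q at *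
  obtain ⟨v, hv⟩ : ∃ v, v = Real.sqrt (2 * u) := ⟨_, rfl⟩
  have hv0 : 0 ≤ v := hv ▸ Real.sqrt_nonneg _
  have hv2 : v ^ 2 = 2 * u := by rw [hv]; exact Real.sq_sqrt (by linarith)
  rw [← hv] at ht
  obtain ⟨s, hs⟩ : ∃ s, s = t * L / d := ⟨_, rfl⟩
  have hts : t = s * d / L := by rw [hs]; field_simp
  have hs1 : u + 1 + v ≤ s := by
    rw [hs, le_div_iff₀ hD]
    have := mul_le_mul_of_nonneg_right ht hL.le
    calc (u + 1 + v) * d = d / L * (u + 1 + v) * L := by field_simp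
      _ ≤ _ := this
  have hs00 : 0 < u + 1 + v := by linarith
  have hs0 : 0 < s := by linarith
  have key : Real.log s - s + u + 1 ≤ 0 := by
    have h1 : Real.log (u + 1 + v) ≤ v := by
      rw [Real.log_le_iff_le_exp hs00]
      have := Real.quadratic_le_exp_of_nonneg hv0
      linarith
    have h2 : Real.log (s / (u + 1 + v)) ≤ s / (u + 1 + v) - 1 :=
      Real.log_le_sub_one_of_pos (by positivity)
    rw [Real.log_div hs0.ne' hs00.ne'] at h2
    have h3 : s / (u + 1 + v) - 1 ≤ s - (u + 1 + v) := by
      rw [sub_le_iff_le_add, div_le_iff₀ hs00]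
      nlinarith [mul_nonneg (sub_nonneg.2 hs1) (add_nonneg hu0 hv0)]
    linarith
  have ht0 : 0 < t := by rw [hts]; positivity
  have hdα : 0 < (d:ℝ) ^ α := by positivity
  have hp : 0 < (t * q / μ) ^ d := by positivity
  have hm : 0 < μ ^ t := by positivity
  rw [← Real.log_le_log_iff (by positivity) hδ0, Real.log_mul (by positivity) hm.ne',
    Real.log_mul hdα.ne' hp.ne', Real.log_rpow hD, Real.log_rpow hμ0, Real.log_pow,
    Real.log_div (by positivity) hμ0.ne', Real.log_mul ht0.ne' hq.ne']
  rw [Real.log_div (by positivity) hδ0.ne', Real.log_rpow hD,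
    Real.log_div (by positivity) hq.ne', Real.log_mul hμ0.ne' hL.ne'] at hu
  have hlt : Real.log t = Real.log s + Real.log d - Real.log L := by
    rw [hts, Real.log_div (by positivity) hL.ne', Real.log_mul hs0.ne' hD.ne']
  have htL : t * L = s * d := by rw [hts]; field_simp
  have hu' : d * u = (d + α) * Real.log d - Real.log δ
      - d * (Real.log μ + Real.log L - Real.log q) - d := by
    rw [hu]; field_simp
  have h4 : t * Real.log μ = - (s * d) := by rw [hlogμ, ← htL]; ring
  rw [h4, hlt]
  have := mul_le_mul_of_nonneg_left key hD.le
  linarith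
end

section
/- Let a, b be positive natural numbers and let Φ : Matrix (Fin a) (Fin a) ℂ →ₗ[ℂ] Matrix (Fin b) (Fin b) ℂ be a ℂ-linear map, extended blockwise to id ⊗ Φ : Matrix (Fin a × Fin a) (Fin a × Fin a) ℂ → Matrix (Fin a × Fin b) (Fin a × Fin b) ℂ by ((id ⊗ Φ) M) ((r,i),(r',j)) := (Φ (fun x y => M (r,x) (r',y))) i j. Let Ω : Matrix (Fin a × Fin a) (Fin a × Fin a) ℂ be the unnormalized maximally entangled matrix Ω ((r,x),(r',y)) = (if r = x then 1 else 0) * (if r' = y then 1 else 0). Suppose λ : ℝ with 0 ≤ λ and σ : Matrix (Fin b) (Fin b) ℂ are such that λ • ((1 : Matrix (Fin a) (Fin a) ℂ) ⊗ₖ σ) − (id ⊗ Φ) Ω is positive semidefinite. Then for every vector v : Fin a × Fin a → ℂ, writing ψ_v := vecMulVec v (star v) and ψ_R for its partial trace over the second factor (ψ_R r r' = ∑ x, ψ_v (r,x) (r',x)), the matrix λ • (ψ_R ⊗ₖ σ) − (id ⊗ Φ) ψ_v is positive semidefinite. (This is the content of the paper's Lemma that the max-mutual information I_max(Φ) = sup_ψ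 inf_σ D_max((id⊗Φ)ψ ‖ ψ_R ⊗ σ) is attained at the maximally entangled state ψ⁺ = Ω/a: any feasible pair (λ, σ) for ψ⁺ is feasible for every pure input.) -/
open Matrix Kronecker ComplexOrder

/-- The max-mutual information `I_max` is attained at the maximally entangled state: any
feasible pair `(λ, σ)` for the (unnormalized) maximally entangled input `Ω` is feasible for
every pure input `ψ_v`, with reference marginal `ψ_R`. -/
theorem imax_feasible_of_maximallyEntangled
    (a b : ℕ) (ha : 0 < a) (hb : 0 < b)
    (Φ : Matrix (Fin a) (Fin a) ℂ →ₗ[ℂ] Matrix (Fin b) (Fin b) ℂ)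
    (ext : Matrix (Fin a × Fin a) (Fin a × Fin a) ℂ →
      Matrix (Fin a × Fin b) (Fin a × Fin b) ℂ)
    (hext : ∀ (M : Matrix (Fin a × Fin a) (Fin a × Fin a) ℂ) (r : Fin a) (i : Fin b)
      (r' : Fin a) (j : Fin b),
      ext M (r, i) (r', j) = Φ (fun x y => M (r, x) (r', y)) i j)
    (Ω : Matrix (Fin a × Fin a) (Fin a × Fin a) ℂ)
    (hΩ : ∀ (r x r' y : Fin a),
      Ω (r, x) (r', y) = (if r = x then 1 else 0) * (if r' = y then 1 else 0))
    (lam : ℝ) (hlam : 0 ≤ lam)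
    (σ : Matrix (Fin b) (Fin b) ℂ)
    (hfeas : (lam • ((1 : Matrix (Fin a) (Fin a) ℂ) ⊗ₖ σ) - ext Ω).PosSemidef) :
    ∀ v : Fin a × Fin a → ℂ,
      (lam • ((fun r r' => ∑ x : Fin a, Matrix.vecMulVec v (star v) (r, x) (r', x) :
          Matrix (Fin a) (Fin a) ℂ) ⊗ₖ σ)
        - ext (Matrix.vecMulVec v (star v))).PosSemidef := by
  intro v
  let V : Matrix (Fin a) (Fin a) ℂ := Matrix.of fun r x => v (r, x)
  have h := hfeas.mul_mul_conjTranspose_same (V ⊗ₖ (1 : Matrix (Fin b) (Fin b) ℂ))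
  have h1 : (fun r r' => ∑ x : Fin a, Matrix.vecMulVec v (star v) (r, x) (r', x) :
          Matrix (Fin a) (Fin a) ℂ) = V * Vᴴ := by
    ext r r'
    simp [V, Matrix.mul_apply, Matrix.vecMulVec_apply]
  have hext' : ∀ (M : Matrix (Fin a × Fin a) (Fin a × Fin a) ℂ) (r : Fin a) (i : Fin b)
      (r' : Fin a) (j : Fin b),
      ext M (r, i) (r', j) = Φ (Matrix.of fun x y => M (r, x) (r', y)) i j := hext
  have h2 : ext (Matrix.vecMulVec v (star v)) =
      (V ⊗ₖ (1 : Matrix (Fin b) (Fin b) ℂ)) * ext Ω *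
        (V ⊗ₖ (1 : Matrix (Fin b) (Fin b) ℂ))ᴴ := by
    ext ⟨r, i⟩ ⟨r', j⟩
    have e1 : (Matrix.of fun x y => Matrix.vecMulVec v (star v) (r, x) (r', y)) =
        ∑ s' : Fin a, ∑ s : Fin a, (V r s * star (V r' s')) •
          (Matrix.of fun x y => Ω (s, x) (s', y)) := by
      ext x y
      simp only [Matrix.sum_apply, Matrix.smul_apply, Matrix.of_apply, hΩ]
      simp [V, Matrix.vecMulVec_apply]
    rw [hext', e1]
    simp only [map_sum, map_smul, Matrix.sum_apply, Matrix.smul_apply, Matrix.mul_apply,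
      Fintype.sum_prod_type, Matrix.conjTranspose_apply, Matrix.kroneckerMap_apply,
      Matrix.one_apply, hext']
    simp only [smul_eq_mul, mul_ite, mul_one, mul_zero, ite_mul, zero_mul, Finset.sum_ite_eq,
      Finset.mem_univ, if_true, apply_ite star, star_zero, Finset.sum_mul]
    refine Finset.sum_congr rfl fun s' _ => Finset.sum_congr rfl fun s _ => ?_
    ring
  rw [h1, h2]
  convert h using 1
  rw [Matrix.mul_sub, Matrix.sub_mul, Matrix.mul_smul, Matrix.smul_mul,
    Matrix.conjTranspose_kronecker, ← Matrix.mul_kronecker_mul, ← Matrix.mul_kronecker_mul]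
  simp
end
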